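/- arXiv:2012.10784 — 2 statements merged into one kernel-verified Lean document; each statement's English description precedes it below -/
import Mathlib

section
/- Let q(m,n) = a m² + b m n + c n² be an integral binary quadratic form with a ≠ 0, c ≠ 0 and discriminant Δ = b² − 4ac = δ² for some positive integer δ. Let 1 < p < ∞ and λ > max{1 − 1/p, 1/p}. Then there is a constant C (depending only on λ, p, Δ) such that for every nonnegative f : ℤ → [0,∞], ∑_{n∈ℤ} ( ∑_{m∈ℤ, m≠0} f(q(m,n)) / |m|^λ )^p ≤ C^p · ∑_{k∈ℤ} f(k)^p (all sums taken in the extended nonnegative reals). -/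
open scoped ENNReal

/-- The divisor bound: `d(n) = O(n ^ ε)` for every `ε > 0`. -/
theorem Nat.exists_card_divisors_le_mul_rpow {ε : ℝ} (hε : 0 < ε) :
    ∃ C : ℝ, 0 ≤ C ∧ ∀ n : ℕ, n ≠ 0 → (n.divisors.card : ℝ) ≤ C * (n : ℝ) ^ ε := by
  have hl2 : 0 < Real.log 2 := Real.log_pos (by norm_num)
  set K : ℝ := 1 + 1 / (ε * Real.log 2) with hK
  have hK1 : 1 ≤ K := by
    have : 0 < 1 / (ε * Real.log 2) := by positivity
    linarith
  set P : ℕ := ⌈Real.exp (1 / ε)⌉₊ with hP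
  have key : ∀ q v : ℕ, 2 ≤ q →
      ((v + 1 : ℕ) : ℝ) ≤ (if q < P then K else 1) * ((q ^ v : ℕ) : ℝ) ^ ε := by
    intro q v hq
    have hq0 : (0 : ℝ) < q := by positivity
    have e1 : ((q ^ v : ℕ) : ℝ) ^ ε = Real.exp (v * Real.log q * ε) := by
      rw [Real.rpow_def_of_pos (by positivity)]
      push_cast
      rw [Real.log_pow]
    have e2 := Real.add_one_le_exp (v * Real.log q * ε)
    have hv : (0 : ℝ) ≤ v := v.cast_nonneg
    rw [e1]
    push_cast
    split_ifs with h
    · have hlq : Real.log 2 ≤ Real.log q := Real.log_le_log (by norm_num) (by exact_mod_cast hq)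
      have e3 : (v : ℝ) * Real.log 2 * ε ≤ v * Real.log q * ε := by gcongr
      calc (v : ℝ) + 1 ≤ K * (v * Real.log 2 * ε + 1) := by
            have : K * (v * Real.log 2 * ε + 1) =
                v * Real.log 2 * ε + 1 + v + 1 / (ε * Real.log 2) := by
              rw [hK]; field_simp; ring
            rw [this]
            have h1 : 0 ≤ (v : ℝ) * Real.log 2 * ε := by positivity
            have h2 : 0 < 1 / (ε * Real.log 2) := by positivity
            linarith
        _ ≤ _ := by gcongr; linarith
    · have h1 : Real.exp (1 / ε) ≤ q := (Nat.le_ceil _).trans (by exact_mod_cast not_lt.1 h)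
      have h2 : 1 / ε ≤ Real.log q := (Real.le_log_iff_exp_le hq0).2 h1
      have h3 : 1 ≤ Real.log q * ε := by rwa [div_le_iff₀ hε] at h2
      nlinarith
  refine ⟨K ^ P, by positivity, fun n hn => ?_⟩
  have hpow : (n : ℝ) ^ ε = ∏ q ∈ n.primeFactors, ((q ^ n.factorization q : ℕ) : ℝ) ^ ε := by
    rw [Real.finsetProd_rpow _ _ (fun _ _ => by positivity), ← Nat.cast_prod]
    congr 2
    exact (Nat.prod_factorization_pow_eq_self hn).symm
  rw [Nat.card_divisors hn, Nat.cast_prod, hpow]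
  calc _ ≤ ∏ q ∈ n.primeFactors, ((if q < P then K else 1) *
          ((q ^ n.factorization q : ℕ) : ℝ) ^ ε) :=
        Finset.prod_le_prod (fun _ _ => by positivity)
          fun q hq => key q _ (Nat.prime_of_mem_primeFactors hq).two_le
    _ = K ^ (n.primeFactors.filter (· < P)).card *
          ∏ q ∈ n.primeFactors, ((q ^ n.factorization q : ℕ) : ℝ) ^ ε := by
        rw [Finset.prod_mul_distrib, Finset.prod_ite]; simp
    _ ≤ _ := by
        gcongr
        · calc _ ≤ (Finset.range P).card :=
                Finset.card_le_card fun q hq => by simpa using (Finset.mem_filter.1 hq).2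
            _ = P := Finset.card_range P

theorem ENNReal.tsum_ite_le_card_mul {α : Type*} (P : α → Prop) [DecidablePred P] (F : Finset α)
    (h : ∀ x, P x → x ∈ F) (c : ℝ≥0∞) : ∑' x, (if P x then c else 0) ≤ F.card * c := by
  rw [tsum_eq_sum (s := F) fun x hx => if_neg fun hp => hx (h x hp), ← nsmul_eq_mul]
  refine Finset.sum_le_card_nsmul _ _ _ fun x _ => ?_
  split_ifs <;> simp

theorem ENNReal.tsum_ite_le_one {α β : Type*} [DecidableEq β] {g : α → β}
    (hg : Function.Injective g) (b : β) : ∑' x, (if g x = b then (1 : ℝ≥0∞) else 0) ≤ 1 :=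
  (ENNReal.tsum_comp_le_tsum_of_injective hg fun y => if y = b then (1 : ℝ≥0∞) else 0).trans
    (by simp)

theorem exists_finset_sq_sub_sq_eq_card_le {N : ℤ} (hN : N ≠ 0) :
    ∃ F : Finset (ℤ × ℤ), F.card ≤ 2 * N.natAbs.divisors.card ∧
      ∀ x : ℤ × ℤ, x.2 ^ 2 - x.1 ^ 2 = N → x ∈ F := by
  classical
  refine ⟨(N.natAbs.divisors ×ˢ ({1, -1} : Finset ℤ)).image fun y =>
    ((N / (y.2 * y.1) - y.2 * y.1) / 2, (N / (y.2 * y.1) + y.2 * y.1) / 2), ?_, ?_⟩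
  · refine Finset.card_image_le.trans ?_
    rw [Finset.card_product, mul_comm]
    gcongr
    exact Finset.card_le_two
  · rintro ⟨h, w⟩ hx
    simp only at hx
    have hfac : (w - h) * (w + h) = N := by rw [← hx]; ring
    have h0 : w - h ≠ 0 := fun h' => hN (by rw [← hfac, h', zero_mul])
    refine Finset.mem_image.2 ⟨((w - h).natAbs, (w - h).sign), ?_, ?_⟩
    · simp only [Finset.mem_product, Nat.mem_divisors, Finset.mem_insert, Finset.mem_singleton]
      refine ⟨⟨Int.natAbs_dvd_natAbs.2 ⟨_, hfac.symm⟩, by simpa using hN⟩, ?_⟩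
      rcases lt_or_gt_of_ne h0 with h1 | h1
      · exact Or.inr (Int.sign_eq_neg_one_of_neg h1)
      · exact Or.inl (Int.sign_eq_one_of_pos h1)
    · have e : N / (w - h) = w + h := by rw [← hfac, Int.mul_ediv_cancel_left _ h0]
      simp only [Int.sign_mul_natAbs, e, Prod.mk.injEq]
      constructor <;> omega

theorem abs_le_abs_of_sq_sub_sq_eq {N h w h' w' : ℤ} (e : w ^ 2 - h ^ 2 = N)
    (e' : w' ^ 2 - h' ^ 2 = N) (l : h ^ 4 < |N|) : |w| ≤ |w'| := by
  by_contra! hlt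
  have hN : 0 < N := by
    by_contra! hN
    rw [abs_of_nonpos hN] at l
    nlinarith [sq_nonneg w, sq_nonneg (h ^ 2 - 1), sq_nonneg h, Int.le_self_sq (h ^ 2)]
  rw [abs_of_pos hN] at l
  have h1 : (h ^ 2) ^ 2 < |w'| ^ 2 := by rw [sq_abs]; nlinarith [sq_nonneg h']
  have h2 : h ^ 2 < |w'| := lt_of_pow_lt_pow_left₀ 2 (abs_nonneg _) h1
  nlinarith [sq_abs w, sq_abs w', sq_nonneg h, sq_nonneg h', abs_nonneg w']

theorem exists_tsum_sq_sub_sq_le {ε : ℝ} (hε : 0 < ε) :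
    ∃ C : ℝ≥0∞, C ≠ ⊤ ∧ ∀ N : ℤ, N ≠ 0 →
      ∑' x : ℤ × ℤ, (if x.2 ^ 2 - x.1 ^ 2 = N ∧ x.1 ≠ 0
        then (x.1.natAbs : ℝ≥0∞) ^ (-ε) else 0) ≤ C := by
  obtain ⟨C, hC0, hC⟩ := Nat.exists_card_divisors_le_mul_rpow (ε := ε / 4) (by positivity)
  refine ⟨2 * ENNReal.ofReal C + 4, by finiteness, fun N hN => ?_⟩
  have hn : N.natAbs ≠ 0 := by simpa using hN
  set n := N.natAbs
  have hpt : ∀ x : ℤ × ℤ, (if x.2 ^ 2 - x.1 ^ 2 = N ∧ x.1 ≠ 0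
        then (x.1.natAbs : ℝ≥0∞) ^ (-ε) else 0) ≤
      (if x.2 ^ 2 - x.1 ^ 2 = N then (n : ℝ≥0∞) ^ (-(ε / 4)) else 0) +
      (if x.2 ^ 2 - x.1 ^ 2 = N ∧ x.1 ^ 4 < |N| then 1 else 0) := by
    rintro ⟨h, w⟩
    simp only
    by_cases h1 : w ^ 2 - h ^ 2 = N ∧ h ≠ 0
    · rw [if_pos h1, if_pos h1.1]
      have hh : 1 ≤ h.natAbs := Nat.one_le_iff_ne_zero.2 (by simpa using h1.2)
      by_cases h2 : h ^ 4 < |N|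
      · rw [if_pos ⟨h1.1, h2⟩]
        refine le_add_left ?_
        rw [ENNReal.rpow_neg, ENNReal.inv_le_one]
        exact ENNReal.one_le_rpow (by exact_mod_cast hh) hε
      · refine le_add_right ?_
        rw [ENNReal.rpow_neg, ENNReal.rpow_neg, ENNReal.inv_le_inv]
        have h3 : n ≤ h.natAbs ^ 4 := by
          zify
          rw [Even.pow_abs (by decide)]
          simpa [n] using h2
        calc (n : ℝ≥0∞) ^ (ε / 4) ≤ ((h.natAbs : ℝ≥0∞) ^ (4 : ℝ)) ^ (ε / 4) := by
              gcongr
              exact_mod_cast h3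
          _ = _ := by rw [← ENNReal.rpow_mul]; congr 1; ring
    · rw [if_neg h1]; exact zero_le
  refine (ENNReal.tsum_le_tsum hpt).trans ?_
  rw [ENNReal.tsum_add]
  gcongr
  · obtain ⟨F, hF, hF'⟩ := exists_finset_sq_sub_sq_eq_card_le hN
    refine (ENNReal.tsum_ite_le_card_mul _ F hF' _).trans ?_
    have hd : (n.divisors.card : ℝ≥0∞) ≤ ENNReal.ofReal C * (n : ℝ≥0∞) ^ (ε / 4) := by
      have := ENNReal.ofReal_le_ofReal (hC n hn)
      rwa [ENNReal.ofReal_mul hC0, ENNReal.ofReal_natCast,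
        ← ENNReal.ofReal_rpow_of_pos (by positivity), ENNReal.ofReal_natCast] at this
    calc (F.card : ℝ≥0∞) * (n : ℝ≥0∞) ^ (-(ε / 4))
        ≤ (2 * (ENNReal.ofReal C * (n : ℝ≥0∞) ^ (ε / 4))) * (n : ℝ≥0∞) ^ (-(ε / 4)) := by
          gcongr
          calc (F.card : ℝ≥0∞) ≤ 2 * n.divisors.card := by exact_mod_cast hF
            _ ≤ _ := by gcongr
      _ = 2 * ENNReal.ofReal C * ((n : ℝ≥0∞) ^ (ε / 4) * (n : ℝ≥0∞) ^ (-(ε / 4))) := by ring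
      _ = _ := by
          rw [← ENNReal.rpow_add _ _ (by exact_mod_cast hn) (by finiteness)]
          simp
  · by_cases hex : ∃ x : ℤ × ℤ, x.2 ^ 2 - x.1 ^ 2 = N ∧ x.1 ^ 4 < |N|
    · obtain ⟨⟨h, w⟩, e, l⟩ := hex
      refine (ENNReal.tsum_ite_le_card_mul _ (({h, -h} : Finset ℤ) ×ˢ ({w, -w} : Finset ℤ))
        ?_ _).trans ?_
      · rintro ⟨h', w'⟩ ⟨e', l'⟩
        have hw : |w'| = |w| := le_antisymm (abs_le_abs_of_sq_sub_sq_eq e' e l')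
          (abs_le_abs_of_sq_sub_sq_eq e e' l)
        have hh : h' ^ 2 = h ^ 2 := by
          have := (sq_eq_sq_iff_abs_eq_abs _ _).2 hw
          simp only at e e'
          linarith
        simp only [Finset.mem_product, Finset.mem_insert, Finset.mem_singleton]
        exact ⟨sq_eq_sq_iff_eq_or_eq_neg.1 hh, abs_eq_abs.1 hw⟩
      · rw [mul_one, Finset.card_product]
        have h1 : ({h, -h} : Finset ℤ).card ≤ 2 := Finset.card_le_two
        have h2 : ({w, -w} : Finset ℤ).card ≤ 2 := Finset.card_le_two
        exact_mod_cast (Nat.mul_le_mul h1 h2)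
    · push Not at hex
      rw [ENNReal.tsum_eq_zero.2 fun x => if_neg fun h => (hex x h.1).not_gt h.2]
      exact zero_le

theorem tsum_natAbs_rpow_ne_top {s : ℝ} (hs : 1 < s) :
    ∑' m : {m : ℤ // m ≠ 0}, ((m : ℤ).natAbs : ℝ≥0∞) ^ (-s) ≠ ⊤ := by
  have h := ((Real.summable_abs_int_rpow hs).comp_injective
    (Subtype.val_injective (p := fun m : ℤ => m ≠ 0))).tsum_ofReal_ne_top
  convert h using 3 with m
  have hm : 0 < |((m : ℤ) : ℝ)| := by simpa using m.2
  rw [Function.comp_apply, ← ENNReal.ofReal_rpow_of_pos hm, ← Int.cast_abs, ← Nat.cast_natAbs,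
    ENNReal.ofReal_natCast]

section QuadraticForm

variable {a b c δ : ℤ}

theorem tsum_ite_quadratic_eq_zero_le (ha : a ≠ 0) (hd : b ^ 2 - 4 * a * c = δ ^ 2) (n : ℤ) :
    ∑' m : ℤ, (if a * m ^ 2 + b * m * n + c * n ^ 2 = 0 then (1 : ℝ≥0∞) else 0) ≤ 2 := by
  have hinj : Function.Injective fun m : ℤ => 2 * a * m := mul_right_injective₀ (by simpa using ha)
  calc _ ≤ ∑' m : ℤ, ((if 2 * a * m = (δ - b) * n then (1 : ℝ≥0∞) else 0) +
        (if 2 * a * m = (-δ - b) * n then (1 : ℝ≥0∞) else 0)) := by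
        refine ENNReal.tsum_le_tsum fun m => ?_
        by_cases h : a * m ^ 2 + b * m * n + c * n ^ 2 = 0
        · have h1 : (2 * a * m - (δ - b) * n) * (2 * a * m - (-δ - b) * n) = 0 := by
            linear_combination 4 * a * h + n ^ 2 * hd
          rcases mul_eq_zero.1 h1 with h2 | h2
          · rw [if_pos h, if_pos (sub_eq_zero.1 h2)]; exact le_self_add
          · rw [if_pos h, if_pos (sub_eq_zero.1 h2)]; exact le_add_self
        · rw [if_neg h]; exact zero_le
    _ ≤ 1 + 1 := by
        rw [ENNReal.tsum_add]
        gcongr <;> exact ENNReal.tsum_ite_le_one hinj _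
    _ = 2 := one_add_one_eq_two

theorem tsum_quadratic_eq_zero_le (hc : c ≠ 0) (hd : b ^ 2 - 4 * a * c = δ ^ 2)
    (w : {m : ℤ // m ≠ 0} → ℝ≥0∞) :
    ∑' n : ℤ, ∑' m : {m : ℤ // m ≠ 0},
      (if a * (m : ℤ) ^ 2 + b * (m : ℤ) * n + c * n ^ 2 = 0 then w m else 0) ≤
      2 * ∑' m, w m := by
  rw [ENNReal.tsum_comm, ← ENNReal.tsum_mul_left]
  refine ENNReal.tsum_le_tsum fun m => ?_
  have hd' : b ^ 2 - 4 * c * a = δ ^ 2 := by rw [← hd]; ring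
  calc _ = ∑' n : ℤ, (if c * n ^ 2 + b * n * m + a * (m : ℤ) ^ 2 = 0
          then (1 : ℝ≥0∞) else 0) * w m := by
        refine tsum_congr fun n => ?_
        rw [ite_mul, one_mul, zero_mul]
        congr 2
        ring
    _ ≤ _ := by
        rw [ENNReal.tsum_mul_right]
        gcongr
        exact tsum_ite_quadratic_eq_zero_le hc hd' _

end QuadraticForm

theorem exists_tsum_quadratic_eq_le {ε : ℝ} (hε : 0 < ε) {δ : ℤ} (hδ : δ ≠ 0) :
    ∃ C : ℝ≥0∞, C ≠ ⊤ ∧ ∀ a b c : ℤ, c ≠ 0 → b ^ 2 - 4 * a * c = δ ^ 2 → ∀ k : ℤ, k ≠ 0 →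
      ∑' n : ℤ, ∑' m : {m : ℤ // m ≠ 0},
        (if a * (m : ℤ) ^ 2 + b * (m : ℤ) * n + c * n ^ 2 = k
          then ((m : ℤ).natAbs : ℝ≥0∞) ^ (-ε) else 0) ≤ C := by
  obtain ⟨C, hC, H⟩ := exists_tsum_sq_sub_sq_le hε
  refine ⟨(δ.natAbs : ℝ≥0∞) ^ ε * C, by finiteness, fun a b c hc hd k hk => ?_⟩
  set G : ℤ × ℤ → ℝ≥0∞ := fun x => if x.2 ^ 2 - x.1 ^ 2 = 4 * c * k ∧ x.1 ≠ 0
    then (x.1.natAbs : ℝ≥0∞) ^ (-ε) else 0 with hG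
  set φ : ℤ × {m : ℤ // m ≠ 0} → ℤ × ℤ := fun x => (δ * x.2, 2 * c * x.1 + b * x.2) with hφ
  have hinj : Function.Injective φ := by
    rintro ⟨n, m, hm⟩ ⟨n', m', hm'⟩ h
    simp only [hφ, Prod.mk.injEq] at h
    obtain rfl := mul_left_cancel₀ hδ h.1
    have := mul_left_cancel₀ (mul_ne_zero two_ne_zero hc) (add_right_cancel h.2)
    subst this
    rfl
  rw [← ENNReal.tsum_prod (f := fun (n : ℤ) (m : {m : ℤ // m ≠ 0}) =>
    if a * (m : ℤ) ^ 2 + b * (m : ℤ) * n + c * n ^ 2 = k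
          then ((m : ℤ).natAbs : ℝ≥0∞) ^ (-ε) else 0)]
  calc _ ≤ ∑' x, (δ.natAbs : ℝ≥0∞) ^ ε * G (φ x) := by
        refine ENNReal.tsum_le_tsum ?_
        rintro ⟨n, m, hm⟩
        simp only
        split_ifs with h
        · have h1 : (2 * c * n + b * m) ^ 2 - (δ * m) ^ 2 = 4 * c * k := by
            linear_combination 4 * c * h + m ^ 2 * hd
          have hδ' : (δ.natAbs : ℝ≥0∞) ≠ 0 := by simpa using hδ
          simp only [hG, hφ]
          rw [if_pos ⟨h1, mul_ne_zero hδ hm⟩, Int.natAbs_mul, Nat.cast_mul,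
            ENNReal.mul_rpow_of_ne_top (by finiteness) (by finiteness), ← mul_assoc,
            ← ENNReal.rpow_add _ _ hδ' (by finiteness)]
          simp
        · exact zero_le
    _ = (δ.natAbs : ℝ≥0∞) ^ ε * ∑' x, G (φ x) := ENNReal.tsum_mul_left
    _ ≤ (δ.natAbs : ℝ≥0∞) ^ ε * ∑' x, G x := by
        gcongr
        exact ENNReal.tsum_comp_le_tsum_of_injective hinj G
    _ ≤ _ := by
        gcongr
        exact H _ (by simp [hc, hk])

theorem ENNReal.tsum_mul_rpow_le {α : Type*} {p q : ℝ} (hpq : p.HolderConjugate q)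
    (u v : α → ℝ≥0∞) :
    (∑' x, u x * v x) ^ p ≤ (∑' x, u x ^ q) ^ (p / q) * ∑' x, v x ^ p := by
  let _ : MeasurableSpace α := ⊤
  have h := ENNReal.lintegral_mul_le_Lp_mul_Lq (MeasureTheory.Measure.count (α := α)) hpq.symm
    (f := u) (g := v) measurable_from_top.aemeasurable measurable_from_top.aemeasurable
  simp only [MeasureTheory.lintegral_count, Pi.mul_apply] at h
  calc _ ≤ ((∑' x, u x ^ q) ^ (1 / q) * (∑' x, v x ^ p) ^ (1 / p)) ^ p := by
        gcongr
        exact hpq.nonneg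
    _ = _ := by
        rw [ENNReal.mul_rpow_of_nonneg _ _ hpq.nonneg, ← ENNReal.rpow_mul, ← ENNReal.rpow_mul,
          one_div_mul_cancel hpq.ne_zero, ENNReal.rpow_one, one_div_mul_eq_div]

/-- Discrete fractional integral along a binary quadratic form of positive square
discriminant: `ℓ^p` boundedness for `1 < p < ∞` and `λ > max{1 - 1/p, 1/p}`,
with a constant depending only on `λ, p, Δ`. -/
theorem stmt_0 (p lam : ℝ) (hp : 1 < p) (δ : ℤ) (hδ : 0 < δ)
    (hlam : max (1 - 1 / p) (1 / p) < lam) :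
    ∃ C : ℝ≥0∞, C ≠ ⊤ ∧
      ∀ a b c : ℤ, a ≠ 0 → c ≠ 0 → b ^ 2 - 4 * a * c = δ ^ 2 →
        ∀ f : ℤ → ℝ≥0∞,
          ∑' n : ℤ,
              (∑' m : {m : ℤ // m ≠ 0},
                  f (a * (m : ℤ) ^ 2 + b * (m : ℤ) * n + c * n ^ 2) /
                    (((m : ℤ).natAbs : ℝ≥0∞)) ^ lam) ^ p
            ≤ C ^ p * ∑' k : ℤ, f k ^ p := by
  have hp0 : 0 < p := one_pos.trans hp
  obtain ⟨hl1, hl2⟩ := max_lt_iff.1 hlam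
  obtain ⟨t, ht1, ht2⟩ := exists_between hl1
  have hpq : p.HolderConjugate p.conjExponent := .conjExponent hp
  set q := p.conjExponent
  have hq0 : 0 < q := hpq.symm.pos
  have htq : 1 < t * q := by
    rw [one_div, hpq.one_sub_inv] at ht1
    rwa [inv_lt_iff_one_lt_mul₀ hq0] at ht1
  have hlp : 1 < lam * p := by rwa [div_lt_iff₀ hp0] at hl2
  obtain ⟨C₁, hC₁, H₁⟩ := exists_tsum_quadratic_eq_le (ε := (lam - t) * p)
    (mul_pos (sub_pos.2 ht2) hp0) hδ.ne'
  have hS := tsum_natAbs_rpow_ne_top htq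
  set S := ∑' m : {m : ℤ // m ≠ 0}, ((m : ℤ).natAbs : ℝ≥0∞) ^ (-(t * q))
  have hS₀ := tsum_natAbs_rpow_ne_top hlp
  set S₀ := ∑' m : {m : ℤ // m ≠ 0}, ((m : ℤ).natAbs : ℝ≥0∞) ^ (-(lam * p))
  set D : ℝ≥0∞ := (2 + S) ^ (p / q) * (C₁ + 2 * S₀) with hD
  have hDtop : D ≠ ⊤ := by
    have : 0 ≤ p / q := by positivity
    finiteness
  refine ⟨D ^ (1 / p), ENNReal.rpow_ne_top_of_nonneg (by positivity) hDtop,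
    fun a b c ha hc hd f => ?_⟩
  rw [← ENNReal.rpow_mul, one_div_mul_cancel hp0.ne', ENNReal.rpow_one]
  set Q : ℤ → {m : ℤ // m ≠ 0} → ℤ :=
    fun n m => a * (m : ℤ) ^ 2 + b * (m : ℤ) * n + c * n ^ 2 with hQ
  set τ : ℤ → ℝ := fun k => if k = 0 then 0 else t with hτ
  have hM0 : ∀ m : {m : ℤ // m ≠ 0}, ((m : ℤ).natAbs : ℝ≥0∞) ≠ 0 := fun m => by simpa using m.2
  have hterm : ∀ n m, f (Q n m) / ((m : ℤ).natAbs : ℝ≥0∞) ^ lam =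
      ((m : ℤ).natAbs : ℝ≥0∞) ^ (-τ (Q n m)) *
        (f (Q n m) * ((m : ℤ).natAbs : ℝ≥0∞) ^ (-(lam - τ (Q n m)))) := fun n m => by
    rw [mul_left_comm, ← ENNReal.rpow_add _ _ (hM0 m) (by finiteness), div_eq_mul_inv,
      ← ENNReal.rpow_neg]
    congr 2
    ring
  have hfirst : ∀ n, ∑' m : {m : ℤ // m ≠ 0}, (((m : ℤ).natAbs : ℝ≥0∞) ^ (-τ (Q n m))) ^ q ≤ 2 + S := fun n => by
    calc _ ≤ ∑' m : {m : ℤ // m ≠ 0}, ((if Q n m = 0 then 1 else 0) +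
            ((m : ℤ).natAbs : ℝ≥0∞) ^ (-(t * q))) := by
          refine ENNReal.tsum_le_tsum fun m => ?_
          by_cases h : Q n m = 0
          · simp [hτ, h]
          · simp [hτ, h, ← ENNReal.rpow_mul]
      _ ≤ _ := by
          rw [ENNReal.tsum_add]
          gcongr
          exact (ENNReal.tsum_comp_le_tsum_of_injective Subtype.val_injective fun m : ℤ =>
            if a * m ^ 2 + b * m * n + c * n ^ 2 = 0 then (1 : ℝ≥0∞) else 0).trans
            (tsum_ite_quadratic_eq_zero_le ha hd n)
  have hsecond : ∀ k, ∑' n, ∑' m : {m : ℤ // m ≠ 0}, (if Q n m = k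
      then ((m : ℤ).natAbs : ℝ≥0∞) ^ (-((lam - τ k) * p)) else 0) ≤ C₁ + 2 * S₀ := fun k => by
    by_cases hk : k = 0
    · subst hk
      simp only [hτ, if_true, sub_zero]
      exact (tsum_quadratic_eq_zero_le hc hd _).trans le_add_self
    · simp only [hτ, if_neg hk]
      exact (H₁ a b c hc hd k hk).trans le_self_add
  calc ∑' n, (∑' m : {m : ℤ // m ≠ 0}, f (Q n m) / ((m : ℤ).natAbs : ℝ≥0∞) ^ lam) ^ p
      ≤ ∑' n, (2 + S) ^ (p / q) * ∑' m : {m : ℤ // m ≠ 0}, (f (Q n m) *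
          ((m : ℤ).natAbs : ℝ≥0∞) ^ (-(lam - τ (Q n m)))) ^ p := by
        refine ENNReal.tsum_le_tsum fun n => ?_
        simp only [hterm]
        refine (ENNReal.tsum_mul_rpow_le hpq _ _).trans ?_
        gcongr
        exact hfirst n
    _ = (2 + S) ^ (p / q) * ∑' n, ∑' m : {m : ℤ // m ≠ 0}, ∑' k, f k ^ p * (if Q n m = k
          then ((m : ℤ).natAbs : ℝ≥0∞) ^ (-((lam - τ k) * p)) else 0) := by
        rw [ENNReal.tsum_mul_left]
        congr 1
        refine tsum_congr fun n => tsum_congr fun m => ?_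
        rw [tsum_eq_single (Q n m) fun k hk => by rw [if_neg hk.symm, mul_zero], if_pos rfl,
          ENNReal.mul_rpow_of_nonneg _ _ hp0.le, ← ENNReal.rpow_mul, neg_mul]
    _ = (2 + S) ^ (p / q) * ∑' k, f k ^ p * ∑' n, ∑' m : {m : ℤ // m ≠ 0}, (if Q n m = k
          then ((m : ℤ).natAbs : ℝ≥0∞) ^ (-((lam - τ k) * p)) else 0) := by
        congr 1
        simp only [← ENNReal.tsum_mul_left]
        rw [ENNReal.tsum_comm (α := ℤ) (β := ℤ)]
        exact tsum_congr fun n => ENNReal.tsum_comm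
    _ ≤ (2 + S) ^ (p / q) * ∑' k, f k ^ p * (C₁ + 2 * S₀) := by
        gcongr with k
        exact hsecond k
    _ = _ := by
        rw [ENNReal.tsum_mul_right, hD]
        ring
end

section
/- Let a be an integer such that −a is not the square of any integer, and let λ > 1/2. Then there is a constant C (depending only on a and λ) such that for all integers N and τ, ∑ 1/|m − τ|^λ ≤ C, where the sum (taken in the extended nonnegative reals) ranges over all pairs (m,n) ∈ ℤ² with m ≠ τ and a m² + n² = N. -/
open scoped ENNReal

namespace ConicSum

open Filter Topology Finset

/-- The additive character `θ ↦ exp (2 π i θ)`. -/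
noncomputable def expi (θ : ℝ) : ℂ := Complex.exp ((2 * Real.pi * θ : ℝ) * Complex.I)

theorem expi_add (x y : ℝ) : expi (x + y) = expi x * expi y := by
  rw [expi, expi, expi, ← Complex.exp_add]; congr 1; push_cast; ring

theorem norm_expi (x : ℝ) : ‖expi x‖ = 1 := Complex.norm_exp_ofReal_mul_I _

theorem conj_expi (x : ℝ) : (starRingEnd ℂ) (expi x) = expi (-x) := by
  rw [expi, expi, ← Complex.exp_conj, map_mul, Complex.conj_ofReal, Complex.conj_I]
  congr 1; push_cast; ring

theorem expi_nat_mul (n : ℕ) (x : ℝ) : expi (n * x) = expi x ^ n := by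
  rw [expi, expi, ← Complex.exp_nat_mul]; congr 1; push_cast; ring

theorem expi_eq_one_iff (x : ℝ) : expi x = 1 ↔ ∃ n : ℤ, x = n := by
  rw [expi, Complex.exp_eq_one_iff]
  refine exists_congr fun n => ?_
  have hpi : (Real.pi : ℂ) ≠ 0 := by exact_mod_cast Real.pi_ne_zero
  constructor
  · intro h
    have h1 : (2 * Real.pi * Complex.I) * (x : ℂ) = (2 * Real.pi * Complex.I) * (n : ℂ) := by
      push_cast at h; linear_combination h
    have h2 := mul_left_cancel₀ (by simp [hpi]) h1
    exact_mod_cast h2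
  · rintro rfl; push_cast; ring

theorem expi_intCast (n : ℤ) : expi n = 1 := (expi_eq_one_iff _).2 ⟨n, rfl⟩

theorem expi_sub_round (x : ℝ) : expi (x - round x) = expi x := by
  rw [sub_eq_add_neg, expi_add, ← Int.cast_neg, expi_intCast, mul_one]

theorem four_mul_abs_le_norm_expi_sub_one (x : ℝ) : 4 * |x - round x| ≤ ‖expi x - 1‖ := by
  rw [← expi_sub_round]
  set y := x - round x with hy
  have hy2 : |y| ≤ 1 / 2 := abs_sub_round x
  have h1 : ‖expi y - 1‖ = 2 * |Real.sin (Real.pi * y)| := by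
    rw [expi, mul_comm _ Complex.I, Complex.norm_exp_I_mul_ofReal_sub_one, Real.norm_eq_abs,
      abs_mul, abs_two]
    congr 3; ring
  have h2 : |Real.sin (Real.pi * y)| = Real.sin (Real.pi * |y|) := by
    rw [Real.abs_sin_eq_sin_abs_of_abs_le_pi, abs_mul, abs_of_pos Real.pi_pos]
    rw [abs_mul, abs_of_pos Real.pi_pos]
    nlinarith [Real.pi_pos]
  have h3 := Real.mul_le_sin (x := Real.pi * |y|) (by positivity) (by nlinarith [Real.pi_pos])
  rw [h1, h2]
  have h4 : 2 / Real.pi * (Real.pi * |y|) = 2 * |y| := by field_simp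
  linarith

/-- The Dirichlet kernel `∑ i < L, exp (2 π i θ)`. -/
noncomputable def kernel (L : ℕ) (θ : ℝ) : ℂ := ∑ i ∈ range L, expi θ ^ i

theorem norm_kernel_le (L : ℕ) (θ : ℝ) : ‖kernel L θ‖ ≤ L :=
  (norm_sum_le _ _).trans (by simp [norm_expi])

theorem norm_kernel_mul_le (L : ℕ) (θ : ℝ) : 2 * ‖kernel L θ‖ * |θ - round θ| ≤ 1 := by
  have h1 := geom_sum_mul (expi θ) L
  have h2 : ‖kernel L θ‖ * ‖expi θ - 1‖ ≤ 2 := by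
    rw [← norm_mul, kernel, h1]
    refine (norm_sub_le _ _).trans ?_
    rw [norm_pow, norm_expi, norm_one, one_pow]; norm_num
  have h3 := mul_le_mul_of_nonneg_left (four_mul_abs_le_norm_expi_sub_one θ)
    (norm_nonneg (kernel L θ))
  linarith

theorem summable_inv_one_add_sq : Summable fun k : ℤ => (1 + (k : ℝ) ^ 2)⁻¹ := by
  have h : Summable fun k : ℤ => 1 / (k : ℝ) ^ 2 := Real.summable_one_div_int_pow.2 one_lt_two
  refine (h.add (hasSum_ite_eq (0 : ℤ) (1 : ℝ)).summable).of_nonneg_of_le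
    (fun k => by positivity) fun k => ?_
  rcases eq_or_ne k 0 with rfl | hk
  · simp
  · have : (0 : ℝ) < (k : ℝ) ^ 2 := by positivity
    simp only [hk, if_false, add_zero, one_div]
    gcongr
    linarith

/-- The absolute constant in `largeSieve`. -/
noncomputable def sieveConst : ℝ := 16 * ∑' k : ℤ, (1 + (k : ℝ) ^ 2)⁻¹

theorem sieveConst_nonneg : 0 ≤ sieveConst :=
  mul_nonneg (by norm_num) (tsum_nonneg fun k => by positivity)

theorem norm_kernel_sq_le {K : ℕ} (hK : 0 < K) (θ : ℝ) :
    ‖kernel (2 * K) θ‖ ^ 2 ≤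
      16 * K ^ 2 * (1 + ((⌊(θ - round θ) * K⌋ : ℤ) : ℝ) ^ 2)⁻¹ := by
  set y := θ - round θ
  set k := ⌊y * K⌋ with hk
  have hK' : (0 : ℝ) < K := by exact_mod_cast hK
  have h1 : ‖kernel (2 * K) θ‖ ≤ 2 * K := by simpa using norm_kernel_le (2 * K) θ
  have h2 : 2 * ‖kernel (2 * K) θ‖ * |y| ≤ 1 := norm_kernel_mul_le _ θ
  set d := ‖kernel (2 * K) θ‖
  have hd : 0 ≤ d := norm_nonneg _
  have hk1 : (k : ℝ) ≤ y * K := Int.floor_le _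
  have hk2 : y * K < k + 1 := Int.lt_floor_add_one _
  rw [← div_eq_mul_inv, le_div_iff₀ (by positivity)]
  have hd2 : d ^ 2 ≤ 4 * K ^ 2 := by nlinarith
  have h3 : 2 * d * (|y| * K) ≤ K := by nlinarith
  have h4 : d ^ 2 * (k : ℝ) ^ 2 ≤ 4 * K ^ 2 := by
    rcases lt_trichotomy k (-1) with h | h | h
    · have h5 : (k : ℝ) ≤ -2 := by exact_mod_cast (by omega : k ≤ -2)
      have h6 : -(k : ℝ) / 2 ≤ |y| * K := by
        have : -y ≤ |y| := neg_le_abs y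
        nlinarith
      have h7 : d * -(k : ℝ) ≤ K := by nlinarith
      have h8 : 0 ≤ d * -(k : ℝ) := by nlinarith
      nlinarith
    · rw [h]; push_cast; nlinarith
    · have h5 : (0 : ℝ) ≤ k := by exact_mod_cast (by omega : 0 ≤ k)
      have h6 : (k : ℝ) ≤ |y| * K := by
        have : y ≤ |y| := le_abs_self y
        nlinarith
      have h7 : d * (k : ℝ) ≤ K := by nlinarith
      have h8 : 0 ≤ d * (k : ℝ) := by positivity
      nlinarith
  nlinarith

variable {ι : Type*}

theorem sum_norm_kernel_sq_le {s : Finset ι} {x : ι → ℝ} {K : ℕ} (hK : 0 < K)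
    (hx : ∀ i ∈ s, ∀ j ∈ s, i ≠ j → ∀ n : ℤ, 1 ≤ |x i - x j - n| * K) (x₀ : ℝ) :
    ∑ i ∈ s, ‖kernel (2 * K) (x₀ - x i)‖ ^ 2 ≤ sieveConst * K ^ 2 := by
  classical
  have hK' : (0 : ℝ) < K := by exact_mod_cast hK
  set φ : ι → ℤ := fun i => ⌊((x₀ - x i) - round (x₀ - x i)) * K⌋
  have hinj : Set.InjOn φ s := by
    intro i hi j hj hij
    by_contra hne
    have h1 := hx i hi j hj hne (round (x₀ - x j) - round (x₀ - x i))
    have h2 : |((x₀ - x i) - round (x₀ - x i)) * K - ((x₀ - x j) - round (x₀ - x j)) * K| < 1 :=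
      Int.abs_sub_lt_one_of_floor_eq_floor hij
    rw [← sub_mul, abs_mul, abs_of_pos hK'] at h2
    have h3 : |x i - x j - ((round (x₀ - x j) - round (x₀ - x i) : ℤ) : ℝ)| =
        |x₀ - x i - round (x₀ - x i) - (x₀ - x j - round (x₀ - x j))| := by
      rw [← abs_neg]; congr 1; push_cast; ring
    rw [h3] at h1
    linarith
  calc ∑ i ∈ s, ‖kernel (2 * K) (x₀ - x i)‖ ^ 2
      ≤ ∑ i ∈ s, 16 * (K : ℝ) ^ 2 * (1 + ((φ i : ℤ) : ℝ) ^ 2)⁻¹ :=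
        Finset.sum_le_sum fun i _ => norm_kernel_sq_le hK _
    _ = 16 * (K : ℝ) ^ 2 * ∑ k ∈ s.image φ, (1 + (k : ℝ) ^ 2)⁻¹ := by
        rw [← Finset.mul_sum, Finset.sum_image hinj]
    _ ≤ 16 * (K : ℝ) ^ 2 * ∑' k : ℤ, (1 + (k : ℝ) ^ 2)⁻¹ := by
        refine mul_le_mul_of_nonneg_left ?_ (by positivity)
        exact summable_inv_one_add_sq.sum_le_tsum _ fun k _ => by positivity
    _ = sieveConst * K ^ 2 := by rw [sieveConst]; ring

theorem normSq_sum_expi (s : Finset ι) (c : ι → ℂ) (x : ι → ℝ) (m : ℝ) :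
    ((‖∑ r ∈ s, c r * expi (m * x r)‖ ^ 2 : ℝ) : ℂ) =
      ∑ r ∈ s, ∑ t ∈ s, c r * (starRingEnd ℂ) (c t) * expi (m * (x r - x t)) := by
  rw [Complex.ofReal_pow, ← Complex.mul_conj', map_sum, Finset.sum_mul_sum]
  refine Finset.sum_congr rfl fun r _ => Finset.sum_congr rfl fun t _ => ?_
  rw [map_mul, conj_expi, mul_sub, sub_eq_add_neg, expi_add]
  ring

/-- Fejér-smoothed dual large sieve. -/
theorem sum_sum_norm_sq_le {s : Finset ι} {x : ι → ℝ} {K : ℕ} (hK : 0 < K)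
    (hx : ∀ i ∈ s, ∀ j ∈ s, i ≠ j → ∀ n : ℤ, 1 ≤ |x i - x j - n| * K) (c : ι → ℂ) (B : ℤ) :
    ∑ i ∈ range (2 * K), ∑ j ∈ range (2 * K),
      ‖∑ r ∈ s, c r * expi (((B + i + j : ℤ) : ℝ) * x r)‖ ^ 2 ≤
      sieveConst * K ^ 2 * ∑ r ∈ s, ‖c r‖ ^ 2 := by
  set E := ∑ i ∈ range (2 * K), ∑ j ∈ range (2 * K),
      ‖∑ r ∈ s, c r * expi (((B + i + j : ℤ) : ℝ) * x r)‖ ^ 2 with hE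
  have h1 : (E : ℂ) = ∑ r ∈ s, ∑ t ∈ s, c r * (starRingEnd ℂ) (c t) *
      (expi (B * (x r - x t)) * kernel (2 * K) (x r - x t) ^ 2) := by
    rw [hE, Complex.ofReal_sum]
    simp_rw [Complex.ofReal_sum, normSq_sum_expi]
    rw [Finset.sum_congr rfl fun i _ => Finset.sum_comm, Finset.sum_comm]
    refine Finset.sum_congr rfl fun r _ => ?_
    rw [Finset.sum_congr rfl fun i _ => Finset.sum_comm, Finset.sum_comm]
    refine Finset.sum_congr rfl fun t _ => ?_
    rw [kernel, sq, Finset.sum_mul_sum, Finset.mul_sum, Finset.mul_sum]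
    refine Finset.sum_congr rfl fun i _ => ?_
    rw [Finset.mul_sum, Finset.mul_sum]
    refine Finset.sum_congr rfl fun j _ => ?_
    rw [← expi_nat_mul, ← expi_nat_mul, ← expi_add, ← expi_add]
    congr 2
    push_cast; ring
  have hE0 : 0 ≤ E := by positivity
  have h2 : E ≤ ∑ r ∈ s, ∑ t ∈ s, ‖c r‖ * ‖c t‖ * ‖kernel (2 * K) (x r - x t)‖ ^ 2 := by
    have : E = ‖(E : ℂ)‖ := by rw [Complex.norm_real, Real.norm_of_nonneg hE0]
    rw [this, h1]
    refine (norm_sum_le _ _).trans (Finset.sum_le_sum fun r _ => (norm_sum_le _ _).trans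
      (Finset.sum_le_sum fun t _ => ?_))
    rw [norm_mul, norm_mul, norm_mul, norm_expi, norm_pow, RCLike.norm_conj, one_mul]
  have hsymm : ∀ θ, ‖kernel (2 * K) (-θ)‖ = ‖kernel (2 * K) θ‖ := by
    intro θ
    rw [← RCLike.norm_conj, kernel, kernel, map_sum]
    simp_rw [map_pow, conj_expi, neg_neg]
  have h3 : ∑ r ∈ s, ∑ t ∈ s, ‖c r‖ * ‖c t‖ * ‖kernel (2 * K) (x r - x t)‖ ^ 2 ≤
      ∑ r ∈ s, ∑ t ∈ s, ‖c r‖ ^ 2 * ‖kernel (2 * K) (x r - x t)‖ ^ 2 := by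
    have h4 : ∑ r ∈ s, ∑ t ∈ s, ‖c t‖ ^ 2 * ‖kernel (2 * K) (x r - x t)‖ ^ 2 =
        ∑ r ∈ s, ∑ t ∈ s, ‖c r‖ ^ 2 * ‖kernel (2 * K) (x r - x t)‖ ^ 2 := by
      rw [Finset.sum_comm]
      refine Finset.sum_congr rfl fun r _ => Finset.sum_congr rfl fun t _ => ?_
      rw [← hsymm, neg_sub]
    have h5 : ∑ r ∈ s, ∑ t ∈ s, 2 * (‖c r‖ * ‖c t‖ * ‖kernel (2 * K) (x r - x t)‖ ^ 2) ≤
        ∑ r ∈ s, ∑ t ∈ s, (‖c r‖ ^ 2 * ‖kernel (2 * K) (x r - x t)‖ ^ 2 +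
          ‖c t‖ ^ 2 * ‖kernel (2 * K) (x r - x t)‖ ^ 2) := by
      refine Finset.sum_le_sum fun r _ => Finset.sum_le_sum fun t _ => ?_
      nlinarith [mul_nonneg (sq_nonneg (‖c r‖ - ‖c t‖))
        (sq_nonneg ‖kernel (2 * K) (x r - x t)‖)]
    simp_rw [Finset.sum_add_distrib, ← Finset.mul_sum] at h5
    simp_rw [← Finset.mul_sum] at h4 ⊢
    linarith
  refine h2.trans (h3.trans ?_)
  rw [Finset.mul_sum]
  refine Finset.sum_le_sum fun r _ => ?_
  rw [← Finset.mul_sum, mul_comm]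
  exact mul_le_mul_of_nonneg_right (sum_norm_kernel_sq_le hK hx _) (by positivity)

/-- The large sieve inequality for `1 / K`-spaced frequencies and a set of integers contained in
an interval of length `K`. -/
theorem largeSieve {s : Finset ι} {x : ι → ℝ} {K : ℕ} (hK : 0 < K)
    (hx : ∀ i ∈ s, ∀ j ∈ s, i ≠ j → ∀ n : ℤ, 1 ≤ |x i - x j - n| * K) {S : Finset ℤ} {A : ℤ}
    (hS : S ⊆ Ico A (A + K)) :
    ∑ r ∈ s, ‖∑ m ∈ S, expi (m * x r)‖ ^ 2 ≤ sieveConst * K * #S := by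
  have hK' : (0 : ℝ) < K := by exact_mod_cast hK
  set c : ι → ℂ := fun r => (starRingEnd ℂ) (∑ m ∈ S, expi (m * x r)) with hc
  set T := ∑ r ∈ s, ‖∑ m ∈ S, expi (m * x r)‖ ^ 2 with hT
  have hT0 : 0 ≤ T := by positivity
  set g : ℤ → ℂ := fun m => ∑ r ∈ s, c r * expi (m * x r) with hg
  have h1 : (T : ℂ) = ∑ m ∈ S, g m := by
    rw [hT, hg, Finset.sum_comm, Complex.ofReal_sum]
    refine Finset.sum_congr rfl fun r _ => ?_
    rw [← Finset.mul_sum, hc, Complex.ofReal_pow, ← Complex.conj_mul']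
  have h2 : T ^ 2 ≤ #S * ∑ m ∈ S, ‖g m‖ ^ 2 := by
    have h3 : T ≤ ∑ m ∈ S, ‖g m‖ := by
      have : T = ‖(T : ℂ)‖ := by rw [Complex.norm_real, Real.norm_of_nonneg hT0]
      rw [this, h1]
      exact norm_sum_le _ _
    exact (pow_le_pow_left₀ hT0 h3 2).trans sq_sum_le_card_mul_sum_sq
  have h4 : K * ∑ m ∈ S, ‖g m‖ ^ 2 ≤ sieveConst * K ^ 2 * T := by
    have h5 := sum_sum_norm_sq_le hK hx c (A - K)
    have h6 : ∑ r ∈ s, ‖c r‖ ^ 2 = T := by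
      simp only [hc, hT, RCLike.norm_conj]
    rw [h6] at h5
    refine le_trans ?_ h5
    have h7 : K * ∑ m ∈ S, ‖g m‖ ^ 2 = ∑ i ∈ range K, ∑ m ∈ S, ‖g m‖ ^ 2 := by simp
    rw [h7, ← Finset.sum_product', ← Finset.sum_product']
    set f : ℕ × ℕ → ℝ := fun z =>
      ‖∑ r ∈ s, c r * expi (((A - K + z.1 + z.2 : ℤ) : ℝ) * x r)‖ ^ 2 with hf
    set e : ℕ × ℤ → ℕ × ℕ := fun z => (z.1, (z.2 - A + K - z.1).toNat) with he
    have hpos : ∀ z ∈ range K ×ˢ S, 0 < z.2 - A + K - z.1 ∧ z.2 - A + K - z.1 < 2 * K := by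
      intro z hz
      obtain ⟨hz1, hz2⟩ := mem_product.1 hz
      have h8 := Finset.mem_range.1 hz1
      have h9 := Finset.mem_Ico.1 (hS hz2)
      omega
    have hinj : Set.InjOn e (range K ×ˢ S : Finset (ℕ × ℤ)) := by
      intro z hz w hw hzw
      have h8 := hpos z hz
      have h9 := hpos w hw
      simp only [he, Prod.mk.injEq] at hzw
      ext
      · exact hzw.1
      · omega
    calc ∑ z ∈ range K ×ˢ S, ‖g z.2‖ ^ 2 = ∑ z ∈ range K ×ˢ S, f (e z) := by
          refine Finset.sum_congr rfl fun z hz => ?_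
          have h8 := hpos z hz
          have h9 : A - K + (e z).1 + (e z).2 = z.2 := by simp only [he]; omega
          simp only [hf, hg, h9]
      _ = ∑ z ∈ (range K ×ˢ S).image e, f z := (Finset.sum_image hinj).symm
      _ ≤ ∑ z ∈ range (2 * K) ×ˢ range (2 * K), f z := by
          refine Finset.sum_le_sum_of_subset_of_nonneg ?_ fun z _ _ => by positivity
          intro w hw
          obtain ⟨z, hz, rfl⟩ := Finset.mem_image.1 hw
          have h8 := hpos z hz
          have h9 := Finset.mem_range.1 (mem_product.1 hz).1
          simp only [he, mem_product, Finset.mem_range]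
          omega
  have h8 : K * T ^ 2 ≤ #S * (sieveConst * K ^ 2 * T) := by
    have := mul_le_mul_of_nonneg_left h2 hK'.le
    have := mul_le_mul_of_nonneg_left h4 (Nat.cast_nonneg (α := ℝ) #S)
    linarith
  rcases hT0.eq_or_lt with h | h
  · rw [← h]; have := sieveConst_nonneg; positivity
  · have h9 : (T * K) * T ≤ (T * K) * (sieveConst * K * #S) := by linarith
    exact le_of_mul_le_mul_left h9 (by positivity)

/-- An anisotropic conic over a finite field of odd characteristic projects onto roughly half of
the line. -/
theorem two_mul_card_conic_projection_le {F : Type*} [Field F] [Fintype F] [DecidableEq F]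
    (h2 : (2 : F) ≠ 0) {a : F} (ha : ¬ IsSquare (-a)) (N : F) :
    2 * #{m : F | ∃ n, a * m ^ 2 + n ^ 2 = N} ≤ Fintype.card F + 6 := by
  set V : Finset F := {m : F | ∃ n, a * m ^ 2 + n ^ 2 = N} with hV
  rcases V.eq_empty_or_nonempty with h | ⟨m₀, hm₀⟩
  · simp [h]
  have hmem : ∀ m ∈ V, ∃ n, a * m ^ 2 + n ^ 2 = N := fun m hm => by simpa [hV] using hm
  choose! n hn using hmem
  have ha0 : a ≠ 0 := by rintro rfl; exact ha ⟨0, by simp⟩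
  set W : Finset F := {m ∈ V | m ≠ m₀ ∧ a * m ^ 2 ≠ N} with hW
  set Z : Finset F := {m : F | a * m ^ 2 = N} with hZ
  have hZcard : #Z ≤ 2 := by
    rcases Z.eq_empty_or_nonempty with h | ⟨r, hr⟩
    · simp [h]
    · have : Z ⊆ {r, -r} := by
        intro m hm
        simp only [hZ, mem_filter, mem_univ, true_and] at hm hr
        have := mul_left_cancel₀ ha0 (hm.trans hr.symm)
        simpa using sq_eq_sq_iff_eq_or_eq_neg.1 this
      exact (card_le_card this).trans card_le_two
  have hVcard : #V ≤ #W + 3 := by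
    have : V ⊆ W ∪ ({m₀} ∪ Z) := by
      intro m hm
      simp only [hW, hZ, mem_union, mem_filter, mem_singleton, mem_univ, true_and, hm]
      tauto
    have h3 := (card_le_card this).trans (card_union_le _ _)
    have h4 := card_union_le {m₀} Z
    rw [card_singleton] at h4
    omega
  set sg : Bool → F := fun b => if b then 1 else -1 with hsg
  have hsg2 : ∀ b, sg b ^ 2 = 1 := by intro b; cases b <;> simp [hsg]
  have hinj : Set.InjOn (fun z : F × Bool => (sg z.2 * n z.1 - n m₀) / (z.1 - m₀))
      (W ×ˢ (univ : Finset Bool) : Finset (F × Bool)) := by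
    rintro ⟨m, b⟩ hmb ⟨m', b'⟩ hmb' heq
    simp only [coe_product, Set.mem_prod, Finset.mem_coe, hW, mem_filter] at hmb hmb'
    obtain ⟨⟨hmV, hm0, hmN⟩, -⟩ := hmb
    obtain ⟨⟨hmV', hm0', hmN'⟩, -⟩ := hmb'
    have hline : ∀ m ∈ V, m ≠ m₀ → ∀ b, ∀ t, (sg b * n m - n m₀) / (m - m₀) = t →
        m * (t ^ 2 + a) = t ^ 2 * m₀ - a * m₀ - 2 * n m₀ * t ∧
          sg b * n m = n m₀ + t * (m - m₀) := by
      intro m hm hne b t ht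
      have hd : m - m₀ ≠ 0 := sub_ne_zero.2 hne
      rw [div_eq_iff hd] at ht
      refine ⟨?_, by linear_combination ht⟩
      have e1 := hn m hm
      have e2 := hn m₀ hm₀
      apply mul_left_cancel₀ hd
      linear_combination e1 - e2 + (n m) ^ 2 * hsg2 b + (-(sg b * n m) - n m₀ - t * (m - m₀)) * ht
    obtain ⟨e1, e1'⟩ := hline m hmV hm0 b _ rfl
    obtain ⟨e2, e2'⟩ := hline m' hmV' hm0' b' _ heq.symm
    dsimp only at e2 e2'
    set t := (sg b * n m - n m₀) / (m - m₀)
    have ht : t ^ 2 + a ≠ 0 := fun h => ha ⟨t, by linear_combination -h⟩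
    have hmm : m = m' := mul_right_cancel₀ ht (e1.trans e2.symm)
    subst hmm
    have hn0 : n m ≠ 0 := by
      intro h
      have := hn m hmV
      rw [h] at this
      exact hmN (by linear_combination this)
    have hs : sg b = sg b' := mul_right_cancel₀ hn0 (e1'.trans e2'.symm)
    have hbb : b = b' := by
      cases b <;> cases b' <;> simp only [hsg] at hs ⊢ <;> simp at hs
      · exact (h2 (by linear_combination -hs)).elim
      · exact (h2 (by linear_combination hs)).elim
    rw [hbb]
  have hc := card_le_card_of_injOn _ (t := univ) (fun _ _ => by simp) hinj
  rw [card_product, card_univ, card_univ, Fintype.card_bool] at hc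
  omega

open scoped NumberTheorySymbols in
theorem exists_jacobiSym_eq_neg_one_of_squarefree {d : ℤ} (hd : Squarefree d) (hd1 : d ≠ 1) :
    ∃ b : ℕ, Odd b ∧ J(d | b) = -1 := by
  by_cases h : ∃ r : ℕ, r.Prime ∧ r ≠ 2 ∧ (r : ℤ) ∣ d
  · obtain ⟨r, hr, hr2, k, rfl⟩ := h
    have : Fact r.Prime := ⟨hr⟩
    have hodd : Odd r := hr.odd_of_ne_two hr2
    have hk0 : k ≠ 0 := by rintro rfl; simp at hd
    have hrk : ¬ (r : ℤ) ∣ k := by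
      intro hrk
      have := hd r (mul_dvd_mul_left _ hrk)
      exact (Nat.prime_iff_prime_int.1 hr).not_isUnit this
    obtain ⟨u, hu⟩ := FiniteField.exists_nonsquare (F := ZMod r) (by rwa [ZMod.ringChar_zmod_n])
    have hcop : (4 * k.natAbs).Coprime r := by
      refine Nat.Coprime.mul_left ?_ ?_
      · exact (Nat.Coprime.pow_left 2 (Nat.coprime_two_left.2 hodd) : (2 ^ 2).Coprime r)
      · rw [Nat.coprime_comm, hr.coprime_iff_not_dvd]
        rwa [Int.natCast_dvd] at hrk
    obtain ⟨b, hb1, hb2⟩ := Nat.chineseRemainder hcop 1 u.val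
    have hb4 : b % 4 = 1 := hb1.of_mul_right k.natAbs
    have hbodd : Odd b := by rw [Nat.odd_iff]; omega
    refine ⟨b, hbodd, ?_⟩
    have hk : J(k | b) = 1 := by
      rw [jacobiSym.mod_right k hbodd, show b % (4 * k.natAbs) = 1 % (4 * k.natAbs) from hb1,
        ← jacobiSym.mod_right k odd_one, jacobiSym.one_right]
    rw [jacobiSym.mul_left, hk, mul_one, jacobiSym.quadratic_reciprocity_one_mod_four' hodd hb4,
      ← jacobiSym.legendreSym.to_jacobiSym, legendreSym.eq_neg_one_iff]
    have : ((b : ℤ) : ZMod r) = u := by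
      have := (ZMod.natCast_eq_natCast_iff _ _ _).2 hb2
      rw [ZMod.natCast_zmod_val] at this
      simpa using this
    rwa [this]
  · push Not at h
    have hpow : ∀ r : ℕ, r.Prime → r ∣ d.natAbs → r = 2 := fun r hr hrd => by
      by_contra h2
      exact h r hr h2 (Int.natCast_dvd.2 hrd)
    have hsq : Squarefree d.natAbs := Int.squarefree_natAbs.2 hd
    have hle : d.natAbs ∣ 2 := by
      rw [← Nat.prod_primeFactors_of_squarefree hsq]
      have : d.natAbs.primeFactors ⊆ {2} := fun r hr => by
        rw [Finset.mem_singleton]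
        exact hpow r (Nat.prime_of_mem_primeFactors hr) (Nat.dvd_of_mem_primeFactors hr)
      simpa using Finset.prod_dvd_prod_of_subset _ _ (fun r => r) this
    have : d.natAbs = 1 ∨ d.natAbs = 2 := (Nat.dvd_prime Nat.prime_two).1 hle
    have hcases : d = -1 ∨ d = 2 ∨ d = -2 := by omega
    rcases hcases with rfl | rfl | rfl
    · exact ⟨3, by decide, by norm_num⟩
    · exact ⟨3, by decide, by norm_num⟩
    · exact ⟨5, by decide, by norm_num⟩

open scoped NumberTheorySymbols in
theorem exists_jacobiSym_eq_neg_one {D : ℤ} (hD : ¬ ∃ t : ℤ, t ^ 2 = D) :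
    ∃ b : ℕ, Odd b ∧ J(D | b) = -1 := by
  have hD0 : D ≠ 0 := by rintro rfl; exact hD ⟨0, by simp⟩
  obtain ⟨m, s, hms, hm⟩ := Nat.sq_mul_squarefree D.natAbs
  obtain ⟨d, hd, hdD⟩ : ∃ d : ℤ, Squarefree d ∧ D = (s : ℤ) ^ 2 * d := by
    have hc : ((s : ℤ) ^ 2 * m) = |D| := by
      rw [Int.abs_eq_natAbs]; exact_mod_cast hms
    rcases abs_choice D with h | h
    · refine ⟨m, Int.squarefree_natCast.2 hm, by rw [hc, h]⟩
    · refine ⟨-m, ?_, by rw [mul_neg, hc, h, neg_neg]⟩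
      rw [← Int.squarefree_natAbs]; simpa using hm
  have hs0 : s ≠ 0 := by rintro rfl; simp at hdD; exact hD0 hdD
  obtain ⟨b, hb, hbJ⟩ := exists_jacobiSym_eq_neg_one_of_squarefree hd
    (by rintro rfl; exact hD ⟨s, by rw [hdD, mul_one]⟩)
  have hd0 : d.natAbs ≠ 0 := by
    rw [Int.natAbs_ne_zero]; exact hd.ne_zero
  have hcop : b.Coprime (4 * d.natAbs) := by
    refine Nat.Coprime.mul_right ?_ ?_
    · exact (Nat.Coprime.pow_right 2 (Nat.coprime_two_right.2 hb) : b.Coprime (2 ^ 2))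
    · by_contra hg
      have := (jacobiSym.eq_zero_iff (a := d) (b := b)).2
        ⟨hb.pos.ne', by rwa [Int.gcd_comm, Int.gcd_eq_natAbs, Int.natAbs_natCast]⟩
      rw [hbJ] at this
      norm_num at this
  obtain ⟨p, hps, hp, hpb⟩ := Nat.forall_exists_prime_gt_and_modEq (s + 2)
    (mul_ne_zero four_ne_zero hd0) hcop
  have hpo : Odd p := hp.odd_of_ne_two (by omega)
  refine ⟨p, hpo, ?_⟩
  have h1 : J((s : ℤ) ^ 2 | p) = 1 := by
    apply jacobiSym.sq_one'
    rw [Int.gcd_natCast_natCast, ← Nat.coprime_iff_gcd_eq_one, Nat.coprime_comm,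
      hp.coprime_iff_not_dvd]
    intro h
    have := Nat.le_of_dvd (Nat.pos_of_ne_zero hs0) h
    omega
  rw [hdD, jacobiSym.mul_left, h1, one_mul, jacobiSym.mod_right d hpo,
    show p % (4 * d.natAbs) = b % (4 * d.natAbs) from hpb, ← jacobiSym.mod_right d hb, hbJ]

/-- Some invertible residue class modulo `4 D` consists of moduli for which the nonsquare `D`
is a quadratic nonresidue. -/
theorem exists_residueClass_nonsquare {D : ℤ} (hD : ¬ ∃ t : ℤ, t ^ 2 = D) :
    ∃ c : ZMod (4 * D.natAbs), IsUnit c ∧ ∀ p : ℕ, p.Prime → p ≠ 2 →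
      (p : ZMod (4 * D.natAbs)) = c → ¬ IsSquare (D : ZMod p) := by
  obtain ⟨b, hb, hbJ⟩ := exists_jacobiSym_eq_neg_one hD
  refine ⟨b, ?_, fun p hp hp2 hpb => ?_⟩
  · rw [ZMod.isUnit_iff_coprime]
    refine Nat.Coprime.mul_right ?_ ?_
    · exact (Nat.Coprime.pow_right 2 (Nat.coprime_two_right.2 hb) : b.Coprime (2 ^ 2))
    · by_contra hg
      have := (jacobiSym.eq_zero_iff (a := D) (b := b)).2
        ⟨hb.pos.ne', by rwa [Int.gcd_comm, Int.gcd_eq_natAbs, Int.natAbs_natCast]⟩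
      rw [hbJ] at this
      norm_num at this
  · have : Fact p.Prime := ⟨hp⟩
    have hpo := hp.odd_of_ne_two hp2
    have h : p ≡ b [MOD 4 * D.natAbs] := (ZMod.natCast_eq_natCast_iff _ _ _).1 hpb
    rw [← legendreSym.eq_neg_one_iff, jacobiSym.legendreSym.to_jacobiSym,
      jacobiSym.mod_right D hpo, show p % (4 * D.natAbs) = b % (4 * D.natAbs) from h,
      ← jacobiSym.mod_right D hb, hbJ]

/-- On `[0, 1]` there is a polynomial with positive integral lying below the indicator function
of a prescribed subinterval. -/
theorem exists_polynomial_le_indicator {α β : ℝ} (hα : 0 ≤ α) (hαβ : α < β) (hβ : β ≤ 1) :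
    ∃ p : Polynomial ℝ, 0 < ∫ x in (0 : ℝ)..1, p.eval x ∧
      ∀ x ∈ Set.Icc (0 : ℝ) 1, p.eval x ≤ (Set.Icc α β).indicator (fun _ => 1) x := by
  set u : ℝ → ℝ := fun x => max 0 ((x - α) * (β - x)) with hu
  have huc : Continuous u := by fun_prop
  have hu0 : ∀ x, 0 ≤ u x := fun x => le_max_left _ _
  have hI : 0 < ∫ x in (0 : ℝ)..1, u x := by
    refine intervalIntegral.integral_pos one_pos huc.continuousOn (fun x _ => hu0 x)
      ⟨(α + β) / 2, ⟨by linarith, by linarith⟩, ?_⟩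
    refine lt_of_lt_of_le ?_ (le_max_right _ _)
    apply mul_pos <;> linarith
  set I := ∫ x in (0 : ℝ)..1, u x
  obtain ⟨p, hp⟩ := exists_polynomial_near_of_continuousOn 0 1 (fun x => u x - I / 4)
    (by fun_prop) (I / 4) (by positivity)
  refine ⟨p, ?_, fun x hx => ?_⟩
  · have h1 : ∫ x in (0 : ℝ)..1, (u x - I / 2) ≤ ∫ x in (0 : ℝ)..1, p.eval x := by
      apply intervalIntegral.integral_mono_on zero_le_one
        ((huc.sub continuous_const).intervalIntegrable _ _) (p.continuous.intervalIntegrable _ _)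
      intro x hx
      have := abs_lt.1 (hp x hx)
      change u x - I / 2 ≤ _
      linarith [this.1]
    rw [intervalIntegral.integral_sub (huc.intervalIntegrable _ _) (by simp)] at h1
    simp only [intervalIntegral.integral_const, sub_zero, one_smul] at h1
    change I - I / 2 ≤ _ at h1
    linarith
  · have h1 := abs_lt.1 (hp x hx)
    have h2 : p.eval x < u x := by linarith [h1.2]
    refine h2.le.trans ?_
    by_cases hm : x ∈ Set.Icc α β
    · rw [Set.indicator_of_mem hm]
      refine max_le zero_le_one ?_
      have := hm.1
      have := hm.2
      nlinarith
    · rw [Set.indicator_of_notMem hm]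
      refine max_le le_rfl ?_
      by_contra! h
      apply hm
      rcases pos_and_pos_or_neg_and_neg_of_mul_pos h with h | h
      · exact ⟨by linarith, by linarith⟩
      · linarith

/-- Karamata's argument: the asymptotics of a Dirichlet series near its pole extends to sums
weighted by polynomials in `n ^ (-t)`. -/
theorem tendsto_mul_tsum_polynomial {f : ℕ → ℝ} {κ : ℝ} (hf0 : f 0 = 0)
    (hs : ∀ t : ℝ, 0 < t → Summable fun n : ℕ => f n / (n : ℝ) ^ (1 + t))
    (hlim : Tendsto (fun t : ℝ => t * ∑' n : ℕ, f n / (n : ℝ) ^ (1 + t)) (𝓝[>] 0) (𝓝 κ))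
    (p : Polynomial ℝ) :
    (∀ t : ℝ, 0 < t → Summable fun n : ℕ =>
      f n / n * ((n : ℝ) ^ (-t) * p.eval ((n : ℝ) ^ (-t)))) ∧
    Tendsto (fun t : ℝ => t * ∑' n : ℕ, f n / n * ((n : ℝ) ^ (-t) * p.eval ((n : ℝ) ^ (-t))))
      (𝓝[>] 0) (𝓝 (κ * ∫ x in (0 : ℝ)..1, p.eval x)) := by
  induction p using Polynomial.induction_on' with
  | add p q hp hq =>
    have e : ∀ t : ℝ, (fun n : ℕ => f n / n * ((n : ℝ) ^ (-t) * (p + q).eval ((n : ℝ) ^ (-t)))) =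
        fun n : ℕ => f n / n * ((n : ℝ) ^ (-t) * p.eval ((n : ℝ) ^ (-t))) +
          f n / n * ((n : ℝ) ^ (-t) * q.eval ((n : ℝ) ^ (-t))) := by
      intro t; funext n; rw [Polynomial.eval_add]; ring
    refine ⟨fun t ht => ?_, ?_⟩
    · rw [e]; exact (hp.1 t ht).add (hq.1 t ht)
    · have : κ * ∫ x in (0 : ℝ)..1, (p + q).eval x =
          κ * (∫ x in (0 : ℝ)..1, p.eval x) + κ * ∫ x in (0 : ℝ)..1, q.eval x := by
        simp only [Polynomial.eval_add]
        rw [intervalIntegral.integral_add (p.continuous.intervalIntegrable _ _)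
          (q.continuous.intervalIntegrable _ _), mul_add]
      rw [this]
      refine (hp.2.add hq.2).congr' ?_
      filter_upwards [self_mem_nhdsWithin] with t ht
      rw [e, (hp.1 t ht).tsum_add (hq.1 t ht), mul_add]
  | monomial j c =>
    have e : ∀ t : ℝ, (fun n : ℕ => f n / n *
        ((n : ℝ) ^ (-t) * (Polynomial.monomial j c).eval ((n : ℝ) ^ (-t)))) =
        fun n : ℕ => c * (f n / (n : ℝ) ^ (1 + (j + 1) * t)) := by
      intro t
      funext n
      rcases Nat.eq_zero_or_pos n with rfl | hn
      · simp [hf0]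
      have hn' : (0 : ℝ) < n := by exact_mod_cast hn
      rw [Polynomial.eval_monomial, Real.rpow_add hn', Real.rpow_one, mul_comm ((j : ℝ) + 1) t,
        Real.rpow_mul hn'.le, Real.rpow_neg hn'.le, ← Nat.cast_add_one, Real.rpow_natCast]
      have : (n : ℝ) ^ t ≠ 0 := (Real.rpow_pos_of_pos hn' t).ne'
      rw [inv_pow]
      field_simp
      ring
    refine ⟨fun t ht => ?_, ?_⟩
    · rw [e]; exact (hs _ (by positivity)).mul_left c
    · have : κ * ∫ x in (0 : ℝ)..1, (Polynomial.monomial j c).eval x = c / (j + 1) * κ := by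
        simp only [Polynomial.eval_monomial]
        rw [intervalIntegral.integral_const_mul, integral_pow]
        simp
        ring
      rw [this]
      have hsc : Tendsto (fun t : ℝ => ((j : ℝ) + 1) * t) (𝓝[>] (0 : ℝ)) (𝓝[>] 0) := by
        refine tendsto_nhdsWithin_iff.2 ⟨?_, ?_⟩
        · have : Tendsto (fun t : ℝ => ((j : ℝ) + 1) * t) (𝓝 0) (𝓝 (((j : ℝ) + 1) * 0)) :=
            tendsto_id.const_mul _
          rw [mul_zero] at this
          exact this.mono_left nhdsWithin_le_nhds
        · filter_upwards [self_mem_nhdsWithin] with t ht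
          exact Set.mem_Ioi.2 (mul_pos (by positivity) (Set.mem_Ioi.1 ht))
      refine ((hlim.comp hsc).const_mul (c / (j + 1))).congr' ?_
      filter_upwards [self_mem_nhdsWithin] with t ht
      rw [e, tsum_mul_left]
      simp only [Function.comp]
      have : (j : ℝ) + 1 ≠ 0 := by positivity
      field_simp

/-- The coefficients of a nonnegative Dirichlet series with a simple pole carry a positive
proportion of logarithmic mass in every window `[X ^ (1 - ε), X]`. -/
theorem exists_mul_log_le_sum_window {f : ℕ → ℝ} {κ ε : ℝ} (hf : ∀ n, 0 ≤ f n) (hf0 : f 0 = 0)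
    (hs : ∀ t : ℝ, 0 < t → Summable fun n : ℕ => f n / (n : ℝ) ^ (1 + t)) (hκ : 0 < κ)
    (hlim : Tendsto (fun t : ℝ => t * ∑' n : ℕ, f n / (n : ℝ) ^ (1 + t)) (𝓝[>] 0) (𝓝 κ))
    (hε : 0 < ε) (hε1 : ε < 1) :
    ∃ c : ℝ, 0 < c ∧ ∀ᶠ X : ℝ in atTop,
      c * Real.log X ≤ ∑ n ∈ (range (⌊X⌋₊ + 1)).filter fun n : ℕ => X ^ (1 - ε) ≤ (n : ℝ), f n / n := by
  obtain ⟨p, hp, hpi⟩ := exists_polynomial_le_indicator (α := Real.exp (-1))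
    (β := Real.exp (-(1 - ε))) (Real.exp_pos _).le (Real.exp_lt_exp.2 (by linarith))
    (Real.exp_le_one_iff.2 (by linarith))
  obtain ⟨hsum, htend⟩ := tendsto_mul_tsum_polynomial hf0 hs hlim p
  set J := ∫ x in (0 : ℝ)..1, p.eval x
  have hJ : κ * J / 2 < κ * J := by have := mul_pos hκ hp; linarith
  refine ⟨κ * J / 2, by positivity, ?_⟩
  have hX : Tendsto (fun X : ℝ => (Real.log X)⁻¹) atTop (𝓝[>] 0) :=
    tendsto_inv_atTop_nhdsGT_zero.comp Real.tendsto_log_atTop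
  filter_upwards [hX.eventually (htend.eventually (lt_mem_nhds hJ)), eventually_gt_atTop 1]
    with X h1 hX1
  have hlog : 0 < Real.log X := Real.log_pos hX1
  set t := (Real.log X)⁻¹ with ht
  have ht0 : 0 < t := inv_pos.2 hlog
  set F := (range (⌊X⌋₊ + 1)).filter fun n : ℕ => X ^ (1 - ε) ≤ (n : ℝ)
  have key : ∑' n : ℕ, f n / n * ((n : ℝ) ^ (-t) * p.eval ((n : ℝ) ^ (-t))) ≤
      ∑ n ∈ F, f n / n := by
    rw [← Finset.tsum_subtype' F (fun n : ℕ => f n / (n : ℝ)),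
      _root_.tsum_subtype (F : Set ℕ) (fun n : ℕ => f n / (n : ℝ))]
    refine (hsum t ht0).tsum_le_tsum (fun n => ?_) ?_
    · rcases Nat.eq_zero_or_pos n with rfl | hn
      · simp [hf0, Set.indicator_apply]
      have hn' : (0 : ℝ) < n := by exact_mod_cast hn
      have hn1 : (1 : ℝ) ≤ n := by exact_mod_cast hn
      have hg : 0 ≤ f n / n := div_nonneg (hf n) hn'.le
      have hy0 : 0 < (n : ℝ) ^ (-t) := Real.rpow_pos_of_pos hn' _
      have hy1 : (n : ℝ) ^ (-t) ≤ 1 := Real.rpow_le_one_of_one_le_of_nonpos hn1 (by linarith)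
      have hpe := hpi _ ⟨hy0.le, hy1⟩
      by_cases hm : (n : ℝ) ^ (-t) ∈ Set.Icc (Real.exp (-1)) (Real.exp (-(1 - ε)))
      · have hnF : n ∈ (F : Set ℕ) := by
          rw [Real.rpow_def_of_pos hn', Set.mem_Icc, Real.exp_le_exp, Real.exp_le_exp] at hm
          have e : Real.log n * t = Real.log n / Real.log X := by rw [ht]; rfl
          have h3 : Real.log n / Real.log X ≤ 1 := by rw [← e]; linarith [hm.1]
          have h4 : 1 - ε ≤ Real.log n / Real.log X := by rw [← e]; linarith [hm.2]
          rw [div_le_one hlog] at h3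
          rw [le_div_iff₀ hlog] at h4
          have h5 : (n : ℝ) ≤ X := (Real.log_le_log_iff hn' (by linarith)).1 h3
          simp only [F, coe_filter, Finset.mem_range, Set.mem_ofPred_eq]
          refine ⟨Nat.lt_succ_of_le (Nat.le_floor h5), ?_⟩
          rw [Real.rpow_def_of_pos (by linarith), ← Real.le_log_iff_exp_le hn']
          linarith
        rw [Set.indicator_of_mem hnF]
        rw [Set.indicator_of_mem hm] at hpe
        have : (n : ℝ) ^ (-t) * p.eval ((n : ℝ) ^ (-t)) ≤ 1 := by nlinarith
        nlinarith
      · rw [Set.indicator_of_notMem hm] at hpe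
        refine (mul_nonpos_of_nonneg_of_nonpos hg
          (mul_nonpos_of_nonneg_of_nonpos hy0.le hpe)).trans ?_
        exact Set.indicator_nonneg (fun m _ => div_nonneg (hf m) m.cast_nonneg) n
    · exact summable_of_ne_finset_zero (s := F) fun n hn => Set.indicator_of_notMem (by simpa using hn) _
  have h2 : κ * J / 2 < t * ∑ n ∈ F, f n / n := h1.trans_le (mul_le_mul_of_nonneg_left key ht0.le)
  rw [ht, inv_mul_eq_div, lt_div_iff₀ hlog] at h2
  exact h2.le

open ArithmeticFunction.vonMangoldt in
theorem tendsto_mul_tsum_residueClass {q : ℕ} [NeZero q] {c : ZMod q} (hc : IsUnit c) :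
    Tendsto (fun t : ℝ => t * ∑' n : ℕ, residueClass c n / (n : ℝ) ^ (1 + t)) (𝓝[>] 0)
      (𝓝 (q.totient : ℝ)⁻¹) := by
  have H {x : ℝ} (hx : 1 < x) :
      ∑' n, residueClass c n / (n : ℝ) ^ x =
        (LFunctionResidueClassAux c x).re + (q.totient : ℝ)⁻¹ / (x - 1) := by
    refine Complex.ofReal_injective ?_
    simp only [Complex.ofReal_tsum, Complex.ofReal_div, Complex.ofReal_cpow (Nat.cast_nonneg _),
      Complex.ofReal_natCast, Complex.ofReal_add, Complex.ofReal_inv, Complex.ofReal_sub,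
      Complex.ofReal_one]
    simp_rw [← LFunctionResidueClassAux_real hc hx,
      eqOn_LFunctionResidueClassAux hc <| Set.mem_ofPred.mpr (Complex.ofReal_re x ▸ hx),
      sub_add_cancel, LSeries, LSeries.term]
    refine tsum_congr fun n ↦ ?_
    split_ifs with hn
    · simp only [hn, residueClass_apply_zero, Complex.ofReal_zero, zero_div]
    · rfl
  have hcont : ContinuousOn (fun x : ℝ ↦ (LFunctionResidueClassAux c x).re) (Set.Ici 1) :=
    Complex.continuous_re.continuousOn.comp (t := Set.univ) (continuousOn_LFunctionResidueClassAux c)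
      (fun ⦃x⦄ a ↦ trivial) |>.comp Complex.continuous_ofReal.continuousOn fun x hx ↦ by
        simpa only [Set.mem_ofPred_eq, Complex.ofReal_re] using Set.mem_Ici.1 hx
  have h1 : Tendsto (fun t : ℝ => 1 + t) (𝓝[>] 0) (𝓝[Set.Ici 1] 1) := by
    refine tendsto_nhdsWithin_iff.2 ⟨?_, ?_⟩
    · have : Tendsto (fun t : ℝ => 1 + t) (𝓝 0) (𝓝 (1 + 0)) := tendsto_id.const_add 1
      rw [add_zero] at this
      exact this.mono_left nhdsWithin_le_nhds
    · filter_upwards [self_mem_nhdsWithin] with t ht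
      have : (0 : ℝ) < t := ht
      simp only [Set.mem_Ici]; linarith
  have h2 := ((hcont 1 (by simp)).tendsto).comp h1
  have h3 : Tendsto (fun t : ℝ => t) (𝓝[>] 0) (𝓝 0) := nhdsWithin_le_nhds
  have h4 := (h3.mul h2).add_const ((q.totient : ℝ)⁻¹)
  rw [zero_mul, zero_add] at h4
  refine h4.congr' ?_
  filter_upwards [self_mem_nhdsWithin] with t ht
  have ht' : (0 : ℝ) < t := ht
  rw [H (by linarith)]
  simp only [Function.comp]
  rw [add_sub_cancel_left]
  field_simp

open ArithmeticFunction.vonMangoldt in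
/-- Every invertible residue class contains `≫ X ^ (1 - ε)` primes in `[X ^ (1 - ε), X]`. -/
theorem exists_mul_rpow_le_card_primes {q : ℕ} [NeZero q] {c : ZMod q} (hc : IsUnit c) {ε : ℝ}
    (hε : 0 < ε) (hε1 : ε < 1) :
    ∃ κ : ℝ, 0 < κ ∧ ∀ᶠ X : ℝ in atTop, κ * X ^ (1 - ε) ≤
      #((range (⌊X⌋₊ + 1)).filter fun p : ℕ =>
        X ^ (1 - ε) ≤ (p : ℝ) ∧ p.Prime ∧ (p : ZMod q) = c) := by
  classical
  have hs : ∀ t : ℝ, 0 < t → Summable fun n : ℕ => residueClass c n / (n : ℝ) ^ (1 + t) := by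
    intro t ht
    refine LSeries.summable_real_of_abscissaOfAbsConv_lt <|
        (abscissaOfAbsConv_residueClass_le_one c).trans_lt ?_
    exact_mod_cast (by linarith : (1 : ℝ) < 1 + t)
  obtain ⟨k, hk, hev⟩ := exists_mul_log_le_sum_window (residueClass_nonneg c)
    (residueClass_apply_zero c) hs
    (inv_pos.mpr (mod_cast q.totient.pos_of_neZero)) (tendsto_mul_tsum_residueClass hc) hε hε1
  have hnp := summable_residueClass_non_primes_div c
  set C := ∑' n : ℕ, (if n.Prime then 0 else residueClass c n) / (n : ℝ)
  refine ⟨k / 2, by positivity, ?_⟩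
  filter_upwards [hev, eventually_gt_atTop 1,
    Real.tendsto_log_atTop.eventually_ge_atTop (2 * C / k)] with X h1 hX1 hXC
  have hlog : 0 < Real.log X := Real.log_pos hX1
  have hXp : 0 < X ^ (1 - ε) := Real.rpow_pos_of_pos (by linarith) _
  set F := (range (⌊X⌋₊ + 1)).filter fun n : ℕ => X ^ (1 - ε) ≤ (n : ℝ)
  set G := (range (⌊X⌋₊ + 1)).filter fun p : ℕ =>
    X ^ (1 - ε) ≤ (p : ℝ) ∧ p.Prime ∧ (p : ZMod q) = c
  have hsplit : ∀ n ∈ F, residueClass c n / n ≤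
      (if n ∈ G then Real.log X / X ^ (1 - ε) else 0) +
        (if n.Prime then 0 else residueClass c n) / (n : ℝ) := by
    intro n hn
    obtain ⟨hn1, hn2⟩ := Finset.mem_filter.1 hn
    have hn0 : (0 : ℝ) < n := hXp.trans_le hn2
    have hnX : (n : ℝ) ≤ X := (Nat.le_floor_iff (by linarith)).1
      (Nat.lt_succ_iff.1 (Finset.mem_range.1 hn1))
    by_cases hp : n.Prime
    · by_cases hnc : (n : ZMod q) = c
      · have : n ∈ G := Finset.mem_filter.2 ⟨hn1, hn2, hp, hnc⟩
        simp only [this, hp, if_true, zero_div, add_zero]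
        refine div_le_div₀ hlog.le ?_ hXp hn2
        exact (residueClass_le c n).trans
          (ArithmeticFunction.vonMangoldt_le_log.trans (Real.log_le_log hn0 hnX))
      · have h0 : residueClass c n = 0 :=
          Set.indicator_of_notMem (s := {n : ℕ | (n : ZMod q) = c}) hnc _
        rw [h0, zero_div]
        simp only [hp, if_true, zero_div, add_zero]
        split_ifs <;> positivity
    · simp only [hp, if_false]
      have : 0 ≤ (if n ∈ G then Real.log X / X ^ (1 - ε) else 0) := by split_ifs <;> positivity
      linarith
  have h2 := h1.trans (Finset.sum_le_sum hsplit)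
  rw [Finset.sum_add_distrib] at h2
  have h3 : ∑ n ∈ F, (if n.Prime then 0 else residueClass c n) / (n : ℝ) ≤ C :=
    hnp.sum_le_tsum _ fun n _ => by
      have := residueClass_nonneg c n
      split_ifs <;> positivity
  have h4 : ∑ n ∈ F, (if n ∈ G then Real.log X / X ^ (1 - ε) else 0) ≤
      #G * (Real.log X / X ^ (1 - ε)) := by
    rw [← Finset.sum_filter, Finset.sum_const, nsmul_eq_mul]
    refine mul_le_mul_of_nonneg_right ?_ (by positivity)
    exact_mod_cast Finset.card_le_card fun n hn => (Finset.mem_filter.1 hn).2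
  have h5 : C ≤ k / 2 * Real.log X := by
    rw [div_le_iff₀ hk] at hXC; linarith
  have h6 : k / 2 * Real.log X ≤ #G * (Real.log X / X ^ (1 - ε)) := by linarith
  rw [← mul_div_assoc, le_div_iff₀ hXp] at h6
  have : k / 2 * X ^ (1 - ε) * Real.log X ≤ #G * Real.log X := by linarith
  exact le_of_mul_le_mul_right this hlog

theorem sum_range_expi_mul_div {p : ℕ} (hp : p ≠ 0) (k : ℤ) :
    ∑ b ∈ range p, expi (k * (b / p : ℝ)) = if (k : ZMod p) = 0 then (p : ℂ) else 0 := by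
  have hp' : (p : ℝ) ≠ 0 := by exact_mod_cast hp
  have h1 : ∀ b : ℕ, expi (k * (b / p : ℝ)) = expi (k / p) ^ b := by
    intro b; rw [← expi_nat_mul]; congr 1; ring
  simp_rw [h1]
  have hiff : expi (k / p) = 1 ↔ (k : ZMod p) = 0 := by
    rw [expi_eq_one_iff, ZMod.intCast_zmod_eq_zero_iff_dvd]
    refine exists_congr fun n => ?_
    rw [div_eq_iff hp', mul_comm]
    exact_mod_cast Iff.rfl
  split_ifs with h
  · rw [hiff.2 h]; simp
  · have h2 := geom_sum_mul (expi (k / p)) p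
    have h3 : expi (k / p) ^ p = 1 := by
      rw [← expi_nat_mul, mul_div_cancel₀ _ hp', expi_intCast]
    rw [h3, sub_self] at h2
    exact (mul_eq_zero.1 h2).resolve_right (sub_ne_zero.2 fun h4 => h (hiff.1 h4))

/-- Parseval over the residue classes modulo `p`, combined with Cauchy-Schwarz. -/
theorem mul_card_sq_le_card_image_mul_sum {p : ℕ} (hp : p ≠ 0) (S : Finset ℤ) :
    (p : ℝ) * (#S : ℝ) ^ 2 ≤ #(S.image fun m : ℤ => (m : ZMod p)) *
      ∑ b ∈ range p, ‖∑ m ∈ S, expi (m * (b / p : ℝ))‖ ^ 2 := by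
  set V := S.image fun m : ℤ => (m : ZMod p)
  have h1 : ∑ b ∈ range p, ‖∑ m ∈ S, expi (m * (b / p : ℝ))‖ ^ 2 =
      p * ∑ v ∈ V, (#(S.filter fun m : ℤ => (m : ZMod p) = v) : ℝ) ^ 2 := by
    apply Complex.ofReal_injective
    have h2 : ∀ b : ℕ, ((‖∑ m ∈ S, expi (m * (b / p : ℝ))‖ ^ 2 : ℝ) : ℂ) =
        ∑ m ∈ S, ∑ m' ∈ S, expi (((m - m' : ℤ) : ℝ) * (b / p : ℝ)) := by
      intro b
      have := normSq_sum_expi S (fun _ => 1) (fun m : ℤ => (m : ℝ)) (b / p : ℝ)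
      simp only [one_mul, map_one] at this
      simp_rw [mul_comm (_ : ℝ) (b / p : ℝ)]
      rw [this]
      push_cast
      rfl
    rw [Complex.ofReal_sum]
    simp_rw [h2]
    rw [Finset.sum_comm, Finset.sum_congr rfl fun i _ => Finset.sum_comm]
    simp_rw [sum_range_expi_mul_div hp, Int.cast_sub, sub_eq_zero]
    have h3 : ∀ m ∈ S, ∑ m' ∈ S, (if (m : ZMod p) = m' then (p : ℂ) else 0) =
        p * #(S.filter fun m' : ℤ => (m' : ZMod p) = m) := by
      intro m _
      rw [← Finset.sum_filter, Finset.sum_const, nsmul_eq_mul, mul_comm]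
      simp_rw [eq_comm]
    rw [Finset.sum_congr rfl h3, ← Finset.mul_sum]
    push_cast
    congr 1
    rw [← Finset.sum_fiberwise_of_maps_to (s := S) (t := V) (g := fun m : ℤ => (m : ZMod p))
      fun m hm => Finset.mem_image_of_mem _ hm]
    refine Finset.sum_congr rfl fun v _ => ?_
    rw [Finset.sum_congr rfl fun m hm => by rw [(Finset.mem_filter.1 hm).2], Finset.sum_const,
      nsmul_eq_mul, sq]
  have h4 : (#S : ℝ) = ∑ v ∈ V, (#(S.filter fun m : ℤ => (m : ZMod p) = v) : ℝ) := by
    exact_mod_cast Finset.card_eq_sum_card_fiberwise fun m hm => Finset.mem_image_of_mem _ hm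
  have h5 : (#S : ℝ) ^ 2 ≤ #V * ∑ v ∈ V, (#(S.filter fun m : ℤ => (m : ZMod p) = v) : ℝ) ^ 2 := by
    rw [h4]; exact sq_sum_le_card_mul_sum_sq
  rw [h1]
  have := mul_le_mul_of_nonneg_left h5 (Nat.cast_nonneg (α := ℝ) p)
  linarith

/-- Distinct fractions with prime denominators at most `√K` are `1 / K`-separated modulo one. -/
theorem one_le_abs_div_sub_div_sub_mul {K p b r d : ℕ} (hp : p.Prime) (hpK : p ^ 2 ≤ K)
    (hr : r.Prime) (hrK : r ^ 2 ≤ K) (hb : b ∈ Ico 1 p) (hd : d ∈ Ico 1 r)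
    (hne : p = r → b ≠ d) (n : ℤ) :
    1 ≤ |(b / p : ℝ) - (d / r : ℝ) - n| * K := by
  rw [Finset.mem_Ico] at hb hd
  have hp0 : (0 : ℝ) < p := by exact_mod_cast hp.pos
  have hr0 : (0 : ℝ) < r := by exact_mod_cast hr.pos
  have hprK : (p : ℝ) * r ≤ K := by
    have hpK' : (p : ℝ) ^ 2 ≤ K := by exact_mod_cast hpK
    have hrK' : (r : ℝ) ^ 2 ≤ K := by exact_mod_cast hrK
    nlinarith [sq_nonneg ((p : ℝ) - r)]
  have hne0 : (b : ℤ) * r - d * p - n * (p * r) ≠ 0 := by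
    intro h
    have h1 : (p : ℤ) ∣ b * r := ⟨d + n * r, by linear_combination h⟩
    have h2 : p ∣ b * r := by exact_mod_cast h1
    rcases (hp.dvd_mul).1 h2 with h3 | h3
    · exact absurd (Nat.le_of_dvd (by omega) h3) (by omega)
    · have hpr : p = r := (Nat.prime_dvd_prime_iff_eq hp hr).1 h3
      subst hpr
      have h4 : (b : ℤ) - d = n * p := by
        have : (p : ℤ) ≠ 0 := by exact_mod_cast hp.ne_zero
        apply mul_right_cancel₀ this
        linear_combination h
      have h5 : n = 0 := by
        by_contra hn
        have h6 : (p : ℤ) ≤ |(b : ℤ) - d| := by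
          rw [h4, abs_mul, abs_of_nonneg (by positivity : (0 : ℤ) ≤ p)]
          have := Int.one_le_abs hn
          nlinarith
        have h7 : |(b : ℤ) - d| < p := abs_lt.2 ⟨by omega, by omega⟩
        omega
      rw [h5, zero_mul] at h4
      exact hne rfl (by omega)
  have h1 : (1 : ℝ) ≤ |((b : ℤ) * r - d * p - n * (p * r) : ℤ)| := by
    exact_mod_cast Int.one_le_abs hne0
  have h2 : |(b / p : ℝ) - (d / r : ℝ) - n| * (p * r) =
      |((b : ℤ) * r - d * p - n * (p * r) : ℤ)| := by
    conv_lhs => rw [← abs_of_pos (mul_pos hp0 hr0), ← abs_mul]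
    push_cast
    congr 1
    field_simp
  calc (1 : ℝ) ≤ |(b / p : ℝ) - (d / r : ℝ) - n| * (p * r) := by rw [h2]; exact_mod_cast h1
    _ ≤ _ := mul_le_mul_of_nonneg_left hprK (abs_nonneg _)

theorem card_sq_div_three_le_sum {p : ℕ} (hp : 0 < p) {S : Finset ℤ}
    (himg : 4 * #(S.image fun m : ℤ => (m : ZMod p)) ≤ 3 * p) :
    (#S : ℝ) ^ 2 / 3 ≤ ∑ b ∈ Ico 1 p, ‖∑ m ∈ S, expi (m * (b / p : ℝ))‖ ^ 2 := by
  have hp0 : (0 : ℝ) < p := by exact_mod_cast hp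
  have h1 := mul_card_sq_le_card_image_mul_sum hp.ne' S
  rw [Finset.range_eq_Ico, Finset.sum_eq_sum_Ico_succ_bot hp] at h1
  have h0 : ‖∑ m ∈ S, expi (m * (((0 : ℕ) : ℝ) / p : ℝ))‖ ^ 2 = (#S : ℝ) ^ 2 := by
    have : expi 0 = 1 := (expi_eq_one_iff 0).2 ⟨0, by simp⟩
    simp [this]
  rw [h0, zero_add] at h1
  have h2 : (4 : ℝ) * #(S.image fun m : ℤ => (m : ZMod p)) ≤ 3 * p := by
    exact_mod_cast himg
  have hT : 0 ≤ ∑ b ∈ Ico 1 p, ‖∑ m ∈ S, expi (m * (b / p : ℝ))‖ ^ 2 :=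
    Finset.sum_nonneg fun _ _ => sq_nonneg _
  generalize ∑ b ∈ Ico 1 p, ‖∑ m ∈ S, expi (m * (b / p : ℝ))‖ ^ 2 = T at h1 hT ⊢
  generalize #(S.image fun m : ℤ => (m : ZMod p)) = v at h1 h2
  have h3 : (v : ℝ) * ((#S : ℝ) ^ 2 + T) ≤ 3 / 4 * p * ((#S : ℝ) ^ 2 + T) :=
    mul_le_mul_of_nonneg_right (by linarith) (by positivity)
  have h4 : (p : ℝ) * (#S : ℝ) ^ 2 ≤ p * (3 / 4 * ((#S : ℝ) ^ 2 + T)) := by linarith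
  have := le_of_mul_le_mul_left h4 hp0
  linarith

/-- A set of integers in an interval of length `K` which misses a quarter of the residue classes
modulo each prime of a set `P` of primes up to `√K` has `O(K / #P)` elements. -/
theorem card_mul_card_le_of_image_le {P : Finset ℕ} {K : ℕ} (hK : 0 < K)
    (hP : ∀ p ∈ P, p.Prime ∧ p ^ 2 ≤ K) {S : Finset ℤ} {A : ℤ} (hS : S ⊆ Ico A (A + K))
    (himg : ∀ p ∈ P, 4 * #(S.image fun m : ℤ => (m : ZMod p)) ≤ 3 * p) :
    (#P : ℝ) * #S ≤ 3 * sieveConst * K := by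
  have hsp : ∀ i ∈ P.sigma fun p => Ico 1 p, ∀ j ∈ P.sigma fun p => Ico 1 p, i ≠ j → ∀ n : ℤ,
      1 ≤ |(i.2 / i.1 : ℝ) - (j.2 / j.1 : ℝ) - n| * K := by
    rintro ⟨p, b⟩ hi ⟨r, d⟩ hj hij n
    obtain ⟨hp, hb⟩ := Finset.mem_sigma.1 hi
    obtain ⟨hr, hd⟩ := Finset.mem_sigma.1 hj
    refine one_le_abs_div_sub_div_sub_mul (hP p hp).1 (hP p hp).2 (hP r hr).1 (hP r hr).2
      hb hd ?_ n
    rintro rfl rfl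
    exact hij rfl
  have hls := largeSieve (x := fun i : Σ _ : ℕ, ℕ => (i.2 / i.1 : ℝ)) hK hsp hS
  rw [Finset.sum_sigma] at hls
  have h5 := (Finset.sum_le_sum fun p hp =>
    card_sq_div_three_le_sum (hP p hp).1.pos (himg p hp)).trans hls
  rw [Finset.sum_const, nsmul_eq_mul] at h5
  rcases Nat.eq_zero_or_pos #S with h | h
  · rw [h]
    have := sieveConst_nonneg
    simp only [Nat.cast_zero, mul_zero]
    positivity
  · have h' : (0 : ℝ) < #S := by exact_mod_cast h
    have : (#P : ℝ) * #S * #S ≤ 3 * sieveConst * K * #S := by linarith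
    exact le_of_mul_le_mul_right this h'

open Classical in
/-- The integers `m` in `[A, A + K)` such that `N - a m²` is a square. -/
noncomputable def conicSection (a N A : ℤ) (K : ℕ) : Finset ℤ :=
  {m ∈ Ico A (A + K) | ∃ n : ℤ, a * m ^ 2 + n ^ 2 = N}

theorem conicSection_subset (a N A : ℤ) (K : ℕ) : conicSection a N A K ⊆ Ico A (A + K) := by
  classical exact filter_subset _ _

theorem card_conicSection_le_self (a N A : ℤ) (K : ℕ) : #(conicSection a N A K) ≤ K := by
  simpa using card_le_card (conicSection_subset a N A K)

theorem card_image_conicSection_le {a : ℤ} {p : ℕ} (hp : p.Prime) (hp12 : 12 ≤ p)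
    (ha : ¬ IsSquare ((-a : ℤ) : ZMod p)) (N A : ℤ) (K : ℕ) :
    4 * #((conicSection a N A K).image fun m : ℤ => (m : ZMod p)) ≤ 3 * p := by
  classical
  have : Fact p.Prime := ⟨hp⟩
  have h2 : (2 : ZMod p) ≠ 0 := by
    intro h
    have : ((2 : ℕ) : ZMod p) = 0 := by exact_mod_cast h
    rw [ZMod.natCast_eq_zero_iff] at this
    have := Nat.le_of_dvd two_pos this
    omega
  have h1 := two_mul_card_conic_projection_le h2 (a := (a : ZMod p)) (by simpa using ha) N
  rw [ZMod.card] at h1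
  have h3 : (conicSection a N A K).image (fun m : ℤ => (m : ZMod p)) ⊆
      Finset.univ.filter fun m : ZMod p => ∃ n, (a : ZMod p) * m ^ 2 + n ^ 2 = N := by
    intro v hv
    obtain ⟨m, hm, rfl⟩ := Finset.mem_image.1 hv
    obtain ⟨n, hn⟩ := (Finset.mem_filter.1 hm).2
    simp only [Finset.mem_filter, Finset.mem_univ, true_and]
    exact ⟨n, by rw [← hn]; push_cast; ring⟩
  have h4 := card_le_card h3
  omega

/-- Uniformly in `N` and `A`, at most `O(K ^ ((1 + ε) / 2))` integers `m ∈ [A, A + K)` are such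
that `N - a m²` is a square. -/
theorem exists_card_conicSection_le {a : ℤ} (ha : ¬ ∃ t : ℤ, t ^ 2 = -a) {ε : ℝ} (hε : 0 < ε)
    (hε1 : ε < 1) :
    ∃ C : ℝ, 0 ≤ C ∧ ∀ (N A : ℤ) (K : ℕ), 0 < K →
      (#(conicSection a N A K) : ℝ) ≤ C * (K : ℝ) ^ ((1 + ε) / 2) := by
  obtain ⟨c, hc, hcp⟩ := exists_residueClass_nonsquare ha
  have ha0 : -a ≠ 0 := by rintro h; exact ha ⟨0, by simp [h]⟩
  have : NeZero (4 * (-a).natAbs) := ⟨mul_ne_zero four_ne_zero (Int.natAbs_ne_zero.2 ha0)⟩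
  obtain ⟨κ, hκ, hev⟩ := exists_mul_rpow_le_card_primes hc hε hε1
  have hev2 := (tendsto_rpow_atTop (by linarith : 0 < 1 - ε)).eventually_ge_atTop 12
  obtain ⟨X₀, hX₀⟩ := eventually_atTop.1 (hev.and (hev2.and (eventually_gt_atTop 0)))
  have hsC := sieveConst_nonneg
  refine ⟨max (X₀ ^ 2) (3 * sieveConst / κ), le_max_of_le_left (sq_nonneg _),
    fun N A K hK => ?_⟩
  have hK1 : (1 : ℝ) ≤ K := by exact_mod_cast hK
  have hK0 : (0 : ℝ) < K := by linarith
  have hpow : (1 : ℝ) ≤ (K : ℝ) ^ ((1 + ε) / 2) := Real.one_le_rpow hK1 (by linarith)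
  rcases lt_or_ge (Real.sqrt K) X₀ with h | h
  · have h1 : (K : ℝ) ≤ X₀ ^ 2 := by
      rw [← Real.sq_sqrt hK0.le]
      exact pow_le_pow_left₀ (Real.sqrt_nonneg _) h.le 2
    have h2 : (#(conicSection a N A K) : ℝ) ≤ K := by
      exact_mod_cast card_conicSection_le_self a N A K
    calc (#(conicSection a N A K) : ℝ) ≤ X₀ ^ 2 * 1 := by linarith
      _ ≤ _ := mul_le_mul (le_max_left _ _) hpow zero_le_one (le_max_of_le_left (sq_nonneg _))
  · obtain ⟨h1, h2, h3⟩ := hX₀ _ h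
    set X := Real.sqrt K with hX
    set P := (range (⌊X⌋₊ + 1)).filter fun p : ℕ => X ^ (1 - ε) ≤ (p : ℝ) ∧ p.Prime ∧
      (p : ZMod (4 * (-a).natAbs)) = c with hPdef
    have hP12 : ∀ p ∈ P, 12 ≤ p := by
      intro p hp
      have := h2.trans (Finset.mem_filter.1 hp).2.1
      exact_mod_cast this
    have hmain := card_mul_card_le_of_image_le (P := P) (S := conicSection a N A K) hK
      (fun p hp => by
        refine ⟨(Finset.mem_filter.1 hp).2.2.1, ?_⟩
        have h4 := Nat.lt_succ_iff.1 (Finset.mem_range.1 (Finset.mem_filter.1 hp).1)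
        have h5 : (p : ℝ) ≤ X := (Nat.le_floor_iff h3.le).1 h4
        have h6 : (p : ℝ) ^ 2 ≤ K := by
          rw [← Real.sq_sqrt hK0.le]
          exact pow_le_pow_left₀ (by positivity) h5 2
        exact_mod_cast h6)
      (conicSection_subset _ _ _ _)
      (fun p hp => by
        obtain ⟨-, -, hpp, hpc⟩ := Finset.mem_filter.1 hp
        have h12 := hP12 p hp
        exact card_image_conicSection_le hpp h12 (hcp p hpp (by omega) hpc) N A K)
    have hXe : X ^ (1 - ε) = (K : ℝ) ^ ((1 - ε) / 2) := by
      rw [hX, Real.sqrt_eq_rpow, ← Real.rpow_mul hK0.le]; congr 1; ring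
    rw [hXe] at h1
    have h7 : (K : ℝ) = (K : ℝ) ^ ((1 - ε) / 2) * (K : ℝ) ^ ((1 + ε) / 2) := by
      rw [← Real.rpow_add hK0]
      conv_lhs => rw [← Real.rpow_one (K : ℝ)]
      congr 1; ring
    have hy : 0 < (K : ℝ) ^ ((1 - ε) / 2) := Real.rpow_pos_of_pos hK0 _
    have h8 := mul_le_mul_of_nonneg_right h1 (Nat.cast_nonneg (α := ℝ) #(conicSection a N A K))
    have h9 : (K : ℝ) ^ ((1 - ε) / 2) * (κ * #(conicSection a N A K)) ≤
        (K : ℝ) ^ ((1 - ε) / 2) * (3 * sieveConst * (K : ℝ) ^ ((1 + ε) / 2)) := by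
      have h10 := h8.trans hmain
      have h13 := congrArg (3 * sieveConst * ·) h7
      linarith
    have h11 := le_of_mul_le_mul_left h9 hy
    have h12 : (#(conicSection a N A K) : ℝ) ≤ 3 * sieveConst / κ * (K : ℝ) ^ ((1 + ε) / 2) := by
      rw [div_mul_eq_mul_div, le_div_iff₀ hκ]; linarith
    exact h12.trans (mul_le_mul_of_nonneg_right (le_max_right _ _) (by linarith))

open Classical in
/-- Each abscissa of the conic carries at most two lattice points. -/
theorem tsum_conic_le (a N τ : ℤ) (f : ℤ → ℝ≥0∞) :
    ∑' x : {x : ℤ × ℤ // x.1 ≠ τ ∧ a * x.1 ^ 2 + x.2 ^ 2 = N}, f (x : ℤ × ℤ).1 ≤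
      2 * ∑' m : ℤ, if m ≠ τ ∧ ∃ n : ℤ, a * m ^ 2 + n ^ 2 = N then f m else 0 := by
  set F : ℤ → ℝ≥0∞ := fun m => if m ≠ τ ∧ ∃ n : ℤ, a * m ^ 2 + n ^ 2 = N then f m else 0
  let φ : {x : ℤ × ℤ // x.1 ≠ τ ∧ a * x.1 ^ 2 + x.2 ^ 2 = N} → Bool × ℤ :=
    fun x => (decide (0 ≤ x.1.2), x.1.1)
  have hφ : Function.Injective φ := by
    rintro ⟨⟨m, n⟩, h1, h2⟩ ⟨⟨m', n'⟩, h3, h4⟩ h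
    obtain ⟨hs, rfl⟩ := Prod.mk.inj h
    simp only [decide_eq_decide] at hs h2 h4
    have h5 : n ^ 2 = n' ^ 2 := by linarith
    have h6 : n = n' := by
      rcases sq_eq_sq_iff_eq_or_eq_neg.1 h5 with h6 | h6 <;> omega
    exact Subtype.ext (Prod.ext rfl h6)
  calc _ = ∑' x, F (φ x).2 := tsum_congr fun x => (if_pos ⟨x.2.1, x.1.2, x.2.2⟩).symm
    _ ≤ ∑' y : Bool × ℤ, F y.2 := ENNReal.tsum_comp_le_tsum_of_injective hφ fun y => F y.2
    _ = 2 * ∑' m, F m := by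
      rw [ENNReal.tsum_prod (f := fun _ m => F m), tsum_bool, two_mul]

open Classical in
/-- Dyadic decomposition of the sum according to the size of `|m - τ|`. -/
theorem tsum_conic_le_tsum_dyadic (a N τ : ℤ) {lam : ℝ} (hlam : 0 ≤ lam) :
    (∑' m : ℤ, if m ≠ τ ∧ ∃ n : ℤ, a * m ^ 2 + n ^ 2 = N then
      (1 : ℝ≥0∞) / ((m - τ).natAbs : ℝ≥0∞) ^ lam else 0) ≤
      ∑' j : ℕ, (#(conicSection a N (τ - 2 ^ (j + 1)) (2 ^ (j + 2))) : ℝ≥0∞) *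
        (1 / ((2 ^ j : ℕ) : ℝ≥0∞) ^ lam) := by
  set M : ℕ → Finset ℤ := fun j => conicSection a N (τ - 2 ^ (j + 1)) (2 ^ (j + 2))
  set w : ℕ → ℝ≥0∞ := fun j => 1 / ((2 ^ j : ℕ) : ℝ≥0∞) ^ lam
  have hM : ∀ j, (#(M j) : ℝ≥0∞) * w j = ∑' m : ℤ, if m ∈ M j then w j else 0 := by
    intro j
    rw [tsum_eq_sum (s := M j) fun m hm => if_neg hm, Finset.sum_ite_mem, Finset.inter_self,
      Finset.sum_const, nsmul_eq_mul]
  calc _ ≤ ∑' m : ℤ, ∑' j : ℕ, if m ∈ M j then w j else 0 := by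
        refine ENNReal.tsum_le_tsum fun m => ?_
        split_ifs with h
        · set k := (m - τ).natAbs with hk
          have hk0 : k ≠ 0 := Int.natAbs_ne_zero.2 (sub_ne_zero.2 h.1)
          have h1 : 2 ^ Nat.log 2 k ≤ k := Nat.pow_log_le_self 2 hk0
          have h2 : k < 2 ^ (Nat.log 2 k + 1) := Nat.lt_pow_succ_log_self one_lt_two k
          have hm : m ∈ M (Nat.log 2 k) := by
            refine Finset.mem_filter.2 ⟨Finset.mem_Ico.2 ?_, h.2⟩
            generalize Nat.log 2 k = j at h2
            zify at h2
            push_cast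
            rw [pow_succ 2 (j + 1)]
            generalize (2 : ℤ) ^ (j + 1) = z at h2
            omega
          refine le_trans ?_ (ENNReal.le_tsum (Nat.log 2 k))
          rw [if_pos hm]
          exact ENNReal.div_le_div_left (ENNReal.rpow_le_rpow (by exact_mod_cast h1) hlam) _
        · exact zero_le
    _ = ∑' j : ℕ, ∑' m : ℤ, if m ∈ M j then w j else 0 := ENNReal.tsum_comm
    _ = _ := tsum_congr fun j => (hM j).symm

theorem card_mul_one_div_pow_rpow_le {C s lam : ℝ} {M : Finset ℤ} {j : ℕ}
    (hM : (#M : ℝ) ≤ C * ((2 ^ (j + 2) : ℕ) : ℝ) ^ s) :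
    (#M : ℝ≥0∞) * (1 / ((2 ^ j : ℕ) : ℝ≥0∞) ^ lam) ≤
      ENNReal.ofReal (C * 4 ^ s * ((2 : ℝ) ^ (s - lam)) ^ j) := by
  have h2 : (0 : ℝ) < ((2 ^ j : ℕ) : ℝ) := by positivity
  have h1 : (#M : ℝ≥0∞) * (1 / ((2 ^ j : ℕ) : ℝ≥0∞) ^ lam) =
      ENNReal.ofReal (#M * (((2 ^ j : ℕ) : ℝ) ^ lam)⁻¹) := by
    rw [ENNReal.ofReal_mul (Nat.cast_nonneg _), ENNReal.ofReal_natCast,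
      ENNReal.ofReal_inv_of_pos (Real.rpow_pos_of_pos h2 _), ← ENNReal.ofReal_rpow_of_pos h2,
      ENNReal.ofReal_natCast, one_div]
  rw [h1]
  refine ENNReal.ofReal_le_ofReal ?_
  calc _ ≤ C * ((2 ^ (j + 2) : ℕ) : ℝ) ^ s * (((2 ^ j : ℕ) : ℝ) ^ lam)⁻¹ :=
        mul_le_mul_of_nonneg_right hM (by positivity)
    _ = _ := by
      have h3 : ((2 ^ (j + 2) : ℕ) : ℝ) = 4 * ((2 ^ j : ℕ) : ℝ) := by push_cast; ring
      have h4 : ((2 : ℝ) ^ (s - lam)) ^ j = ((2 ^ j : ℕ) : ℝ) ^ (s - lam) := by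
        push_cast
        rw [← Real.rpow_natCast, ← Real.rpow_natCast, ← Real.rpow_mul two_pos.le,
          ← Real.rpow_mul two_pos.le, mul_comm]
      rw [h3, h4, Real.mul_rpow (by norm_num) h2.le, Real.rpow_sub h2]
      ring

end ConicSum

/-- Uniform bound for `∑ 1/|m-τ|^λ` over lattice points on the conic `a m² + n² = N`,
when `-a` is a nonsquare and `λ > 1/2`, uniformly in `N` and `τ`. -/
theorem stmt_3 (a : ℤ) (ha : ¬∃ t : ℤ, t ^ 2 = -a) (lam : ℝ) (hlam : 1 / 2 < lam) :
    ∃ C : ℝ≥0∞, C ≠ ⊤ ∧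
      ∀ N τ : ℤ,
        ∑' x : {x : ℤ × ℤ // x.1 ≠ τ ∧ a * x.1 ^ 2 + x.2 ^ 2 = N},
            (1 : ℝ≥0∞) / ((((x : ℤ × ℤ).1 - τ).natAbs : ℝ≥0∞)) ^ lam ≤ C := by
  have hε : 0 < min (lam - 1 / 2) (1 / 2) := lt_min (by linarith) (by norm_num)
  have hε1 : min (lam - 1 / 2) (1 / 2) ≤ 1 / 2 := min_le_right _ _
  have hε2 : min (lam - 1 / 2) (1 / 2) ≤ lam - 1 / 2 := min_le_left _ _
  generalize min (lam - 1 / 2) (1 / 2) = ε at hε hε1 hε2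
  obtain ⟨C, hC, hbound⟩ := ConicSum.exists_card_conicSection_le ha hε (by linarith)
  set s := (1 + ε) / 2 with hs
  have hr0 : (0 : ℝ) ≤ 2 ^ (s - lam) := by positivity
  have hr1 : (2 : ℝ) ^ (s - lam) < 1 := Real.rpow_lt_one_of_one_lt_of_neg one_lt_two (by linarith)
  refine ⟨2 * ∑' j : ℕ, ENNReal.ofReal (C * 4 ^ s * ((2 : ℝ) ^ (s - lam)) ^ j),
    ENNReal.mul_ne_top ENNReal.ofNat_ne_top
      ((summable_geometric_of_lt_one hr0 hr1).mul_left _).tsum_ofReal_ne_top, fun N τ => ?_⟩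
  refine (ConicSum.tsum_conic_le a N τ fun m => 1 / ((m - τ).natAbs : ℝ≥0∞) ^ lam).trans ?_
  gcongr
  refine (ConicSum.tsum_conic_le_tsum_dyadic a N τ (by linarith)).trans ?_
  exact ENNReal.tsum_le_tsum fun j =>
    ConicSum.card_mul_one_div_pow_rpow_le (hbound _ _ _ (by positivity))
end
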